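/- arXiv:2108.07311 — 2 statements merged into one kernel-verified Lean document; each statement's English description precedes it below -/
import Mathlib

section
/- Let K₁, K₂ ⊆ ℝ be Borel sets each of positive Hausdorff dimension. Then the Cartesian product K = K₁ × K₂ ⊆ ℝ² is curved: there exist β > 0, C > 0, and a Borel probability measure μ supported on K such that for all r > 0, μ³({(p₁,p₂,p₃) ∈ K³ : |T(p₁,p₂,p₃)| < r}) ≤ C r^β, where |T(p₁,p₂,p₃)| is the area of the triangle with vertices p₁, p₂, p₃. -/
open MeasureTheory

/-- The area of the triangle spanned by three points of `ℝ²`. -/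
noncomputable def triArea (p₁ p₂ p₃ : ℝ × ℝ) : ℝ :=
  |(p₂.1 - p₁.1) * (p₃.2 - p₁.2) - (p₂.2 - p₁.2) * (p₃.1 - p₁.1)| / 2

/-- A set `K ⊆ ℝ²` is *curved* if there exist `β > 0`, `C > 0` and a Borel probability
measure `μ` supported on `K` such that for all `r > 0`,
`μ³({(p₁,p₂,p₃) ∈ K³ : |T(p₁,p₂,p₃)| < r}) ≤ C r^β`. -/
def IsCurved (K : Set (ℝ × ℝ)) : Prop :=
  ∃ (β C : ℝ) (μ : Measure (ℝ × ℝ)), 0 < β ∧ 0 < C ∧ IsProbabilityMeasure μ ∧ μ Kᶜ = 0 ∧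
    ∀ r : ℝ, 0 < r →
      (μ.prod (μ.prod μ))
          {q : (ℝ × ℝ) × (ℝ × ℝ) × (ℝ × ℝ) |
            q.1 ∈ K ∧ q.2.1 ∈ K ∧ q.2.2 ∈ K ∧ triArea q.1 q.2.1 q.2.2 < r}
        ≤ ENNReal.ofReal (C * r ^ β)

open Set Filter Topology
open scoped ENNReal NNReal

/-- **Choquet capacitability**, for a set function that is monotone, continuous along increasing
sequences and outer regular on compact sets: analytic sets are inner regular by compact sets. -/
theorem MeasureTheory.AnalyticSet.exists_isCompact_le {X : Type*} [TopologicalSpace X]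
    {φ : Set X → ℝ≥0∞} (hmono : Monotone φ)
    (hincr : ∀ E : ℕ → Set X, Monotone E → φ (⋃ n, E n) ≤ ⨆ n, φ (E n))
    (hout : ∀ C, IsCompact C → ∀ c, φ C < c → ∃ U, IsOpen U ∧ C ⊆ U ∧ φ U < c)
    {A : Set X} (hA : AnalyticSet A) {c : ℝ≥0∞} (hc : c < φ A) :
    ∃ C ⊆ A, IsCompact C ∧ c ≤ φ C := by
  rw [AnalyticSet] at hA
  rcases hA with rfl | ⟨f, hf, rfl⟩
  · exact ⟨∅, subset_rfl, isCompact_empty, hc.le⟩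
  have step : ∀ (T : Set (ℕ → ℕ)) (m : ℕ), ∃ k : ℕ,
      c < φ (f '' T) → c < φ (f '' (T ∩ {σ | σ m ≤ k})) := by
    intro T m
    by_cases h : c < φ (f '' T)
    · have hU : f '' T = ⋃ k : ℕ, f '' (T ∩ {σ | σ m ≤ k}) := by
        rw [← image_iUnion, ← inter_iUnion]
        congr 1
        ext σ
        simp only [mem_inter_iff, mem_iUnion, mem_ofPred_eq, iff_self_and]
        exact fun _ => ⟨σ m, le_rfl⟩
      have hm : Monotone fun k : ℕ => f '' (T ∩ {σ | σ m ≤ k}) := fun a b hab =>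
        image_mono (inter_subset_inter_right _ fun σ (hσ : σ m ≤ a) => hσ.trans hab)
      obtain ⟨k, hk⟩ := lt_iSup_iff.1 ((hU ▸ h).trans_le (hincr _ hm))
      exact ⟨k, fun _ => hk⟩
    · exact ⟨0, fun h' => absurd h' h⟩
  choose K hK using step
  let T : ℕ → Set (ℕ → ℕ) := fun m =>
    Nat.rec univ (fun m T => T ∩ {σ | σ m ≤ K T m}) m
  have hTsucc : ∀ m, T (m + 1) = T m ∩ {σ | σ m ≤ K (T m) m} := fun _ => rfl
  let k : ℕ → ℕ := fun m => K (T m) m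
  have hT : ∀ m, c < φ (f '' T m) := by
    intro m
    induction m with
    | zero => simpa [T] using hc
    | succ m ih => exact hK _ _ ih
  have hTk : ∀ m, ∀ σ ∈ T m, ∀ i < m, σ i ≤ k i := by
    intro m
    induction m with
    | zero => simp
    | succ m ih =>
      intro σ hσ i hi
      rw [hTsucc] at hσ
      rcases Nat.lt_succ_iff_lt_or_eq.1 hi with h | rfl
      · exact ih σ hσ.1 i h
      · exact hσ.2
  let S : Set (ℕ → ℕ) := univ.pi fun i => Iic (k i)
  have hS : IsCompact S := isCompact_univ_pi fun i => (finite_Iic (k i)).isCompact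
  refine ⟨f '' S, image_subset_range _ _, hS.image hf, ?_⟩
  by_contra! hlt
  obtain ⟨U, hUo, hSU, hUc⟩ := hout _ (hS.image hf) c hlt
  have key : ∃ m, T m ⊆ f ⁻¹' U := by
    by_contra! hno
    choose σ hσT hσU using fun m => not_subset.1 (hno m)
    let τ : ℕ → ℕ → ℕ := fun m i => if i < m then σ m i else 0
    have hτS : ∀ m, τ m ∈ S := by
      intro m i _
      simp only [τ, mem_Iic]
      split_ifs with h
      · exact hTk m _ (hσT m) i h
      · exact Nat.zero_le _
    obtain ⟨ρ, hρS, ψ, hψ, hlim⟩ := hS.tendsto_subseq hτS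
    have hlim' : Tendsto (fun j => σ (ψ j)) atTop (𝓝 ρ) := by
      rw [tendsto_pi_nhds] at hlim ⊢
      intro i
      refine (hlim i).congr' ?_
      filter_upwards [hψ.tendsto_atTop.eventually_gt_atTop i] with j hj
      simp [τ, hj]
    have hmem : f ⁻¹' U ∈ 𝓝 ρ := (hUo.preimage hf).mem_nhds (hSU (mem_image_of_mem f hρS))
    obtain ⟨j, hj⟩ := (hlim'.eventually hmem).exists
    exact hσU _ hj
  obtain ⟨m, hm⟩ := key
  exact lt_asymm hUc ((hT m).trans_le (hmono (image_subset_iff.2 hm)))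

/-- In a Hilbert lattice, a decreasing sequence of convex sets all meeting a given ball admits
elements with a common upper bound whose norm exceeds the radius by an arbitrarily small amount. -/
theorem exists_norm_le_forall_exists_le_of_antitone_convex {H : Type*} [NormedAddCommGroup H]
    [Lattice H] [HasSolidNorm H] [IsOrderedAddMonoid H] [InnerProductSpace ℝ H] [CompleteSpace H]
    {C : ℕ → Set H} (hanti : Antitone C) (hconv : ∀ n, Convex ℝ (C n)) {c : ℝ}
    (hc : ∀ n, ∃ f ∈ C n, ‖f‖ ≤ c) {ε : ℝ} (hε : 0 < ε) :
    ∃ g, ‖g‖ ≤ c + ε ∧ ∀ n, ∃ f ∈ C n, f ≤ g := by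
  let d : ℕ → ℝ := fun n => sInf (norm '' C n)
  have hbdd : ∀ n, BddBelow (norm '' C n) := fun n => ⟨0, by rintro _ ⟨f, -, rfl⟩; positivity⟩
  have hne : ∀ n, (norm '' C n).Nonempty := fun n =>
    let ⟨f, hf, _⟩ := hc n
    ⟨_, mem_image_of_mem _ hf⟩
  have hd_le : ∀ n, ∀ f ∈ C n, d n ≤ ‖f‖ := fun n f hf => csInf_le (hbdd n) (mem_image_of_mem _ hf)
  have hd_nonneg : ∀ n, 0 ≤ d n := fun n =>
    le_csInf (hne n) (by rintro _ ⟨f, -, rfl⟩; positivity)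
  have hd_mono : Monotone d := fun m n hmn =>
    csInf_le_csInf (hbdd m) (hne n) (image_mono (hanti hmn))
  have hdc : ∀ n, d n ≤ c := fun n =>
    let ⟨f, hf, hfc⟩ := hc n
    (hd_le n f hf).trans hfc
  have hbd : BddAbove (range d) := ⟨c, by rintro _ ⟨n, rfl⟩; exact hdc n⟩
  let L := ⨆ n, d n
  have hlim : Tendsto d atTop (𝓝 L) := tendsto_atTop_ciSup hd_mono hbd
  have hL : L ≤ c := ciSup_le hdc
  have hdL : ∀ n, d n ≤ L := fun n => le_ciSup hbd n
  let η : ℕ → ℝ := fun n => ε / 2 * (1 / (n + 1))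
  have hη : ∀ n, 0 < η n := fun n => by positivity
  have hη_anti : Antitone η := fun m n h =>
    mul_le_mul_of_nonneg_left (one_div_le_one_div_of_le (by positivity) (by gcongr))
      (by positivity)
  have hη_le : ∀ n, η n ≤ ε / 2 := fun n => by simpa [η] using hη_anti (Nat.zero_le n)
  have hη_lim : Tendsto η atTop (𝓝 0) := by
    simpa [η] using tendsto_one_div_add_atTop_nhds_zero_nat.const_mul (ε / 2)
  have hex : ∀ n, ∃ f ∈ C n, ‖f‖ < d n + η n := by
    intro n
    obtain ⟨_, ⟨f, hf, rfl⟩, h⟩ := exists_lt_of_csInf_lt (hne n)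
      (show sInf (norm '' C n) < d n + η n by linarith [hη n])
    exact ⟨f, hf, h⟩
  choose f hfC hf using hex
  have hfL : ∀ n, ‖f n‖ ≤ L + η n := fun n => by linarith [hf n, hdL n]
  have hcauchy : CauchySeq f := by
    refine cauchySeq_of_le_tendsto_0 (fun k => √(4 * (L + η k) ^ 2 - 4 * d k ^ 2)) ?_ ?_
    · intro n m k hn hm
      rw [dist_eq_norm]
      apply Real.le_sqrt_of_sq_le
      have hmid : (1 / 2 : ℝ) • f n + (1 / 2 : ℝ) • f m ∈ C k :=
        hconv k (hanti hn (hfC n)) (hanti hm (hfC m)) (by norm_num) (by norm_num) (by norm_num)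
      have h1 : 2 * d k ≤ ‖f n + f m‖ := by
        have := hd_le k _ hmid
        rw [← smul_add, norm_smul] at this
        norm_num at this
        linarith
      have h2 := parallelogram_law_with_norm ℝ (f n) (f m)
      have h3 : ‖f n‖ ≤ L + η k := (hfL n).trans (by linarith [hη_anti hn])
      have h4 : ‖f m‖ ≤ L + η k := (hfL m).trans (by linarith [hη_anti hm])
      have h5 := pow_le_pow_left₀ (norm_nonneg _) h3 2
      have h6 := pow_le_pow_left₀ (norm_nonneg _) h4 2
      have h7 := pow_le_pow_left₀ (mul_nonneg zero_le_two (hd_nonneg k)) h1 2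
      linarith
    · have : Tendsto (fun k => √(4 * (L + η k) ^ 2 - 4 * d k ^ 2)) atTop
          (𝓝 (√(4 * (L + 0) ^ 2 - 4 * L ^ 2))) :=
        ((((hη_lim.const_add L).pow 2).const_mul 4).sub ((hlim.pow 2).const_mul 4)).sqrt
      simpa using this
  obtain ⟨ψ, hψ, hψd⟩ := hcauchy.subseq_mem (V := fun n => {p | dist p.1 p.2 < ε / 2 / 2 / 2 ^ n})
    fun n => Metric.dist_mem_uniformity (by positivity)
  have hnorm : ∀ j, ‖|f (ψ (j + 1)) - f (ψ j)|‖ ≤ ε / 2 / 2 / 2 ^ j := fun j => by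
    rw [norm_abs_eq_norm, ← dist_eq_norm]
    exact (hψd j).le
  have hsum := hasSum_geometric_two' (ε / 2)
  have hsummable : Summable fun j => |f (ψ (j + 1)) - f (ψ j)| :=
    Summable.of_norm_bounded hsum.summable hnorm
  refine ⟨f (ψ 0) + ∑' j, |f (ψ (j + 1)) - f (ψ j)|, ?_, fun n => ⟨f (ψ n),
    hanti hψ.le_apply (hfC _), ?_⟩⟩
  · calc _ ≤ ‖f (ψ 0)‖ + ‖∑' j, |f (ψ (j + 1)) - f (ψ j)|‖ := norm_add_le _ _
      _ ≤ (c + ε / 2) + ε / 2 :=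
        add_le_add (by linarith [hfL (ψ 0), hη_le (ψ 0)]) (tsum_of_norm_bounded hsum hnorm)
      _ = c + ε := by ring
  · calc f (ψ n) = f (ψ 0) + ∑ j ∈ Finset.range n, (f (ψ (j + 1)) - f (ψ j)) := by
          rw [Finset.sum_range_sub fun j => f (ψ j)]
          abel
      _ ≤ f (ψ 0) + ∑ j ∈ Finset.range n, |f (ψ (j + 1)) - f (ψ j)| := by
          gcongr
          exact le_abs_self _
      _ ≤ _ := by
          gcongr
          exact hsummable.sum_le_tsum _ fun _ _ => abs_nonneg _

/-- The dyadic grid of open intervals: `(n, k)` indexes the interval of centre `k / 2 ^ n` and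
radius `1 / 2 ^ n`. -/
def dyadicBall (i : ℕ × ℤ) : Set ℝ :=
  Metric.ball (i.2 / 2 ^ i.1) ((1 / 2) ^ i.1)

/-- The space of square-summable weights on the dyadic grid. -/
abbrev DyadicWeight : Type :=
  Lp ℝ 2 (Measure.count : Measure (ℕ × ℤ))

/-- The potential at `x` of a weight on the dyadic grid. -/
noncomputable def dyadicPotential (t : ℝ) (f : ℕ × ℤ → ℝ) (x : ℝ) : ℝ≥0∞ :=
  ∑' i, (dyadicBall i).indicator (fun _ => ENNReal.ofReal (2 ^ (t * i.1) * f i)) x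

/-- The nonnegative weights whose potential is at least one on `E`. -/
def admissibleWeights (t : ℝ) (E : Set ℝ) : Set DyadicWeight :=
  {f | 0 ≤ f ∧ ∀ x ∈ E, 1 ≤ dyadicPotential t f x}

/-- The quadratic capacity attached to the dyadic potentials (in its norm version). -/
noncomputable def dyadicCapacity (t : ℝ) (E : Set ℝ) : ℝ≥0∞ :=
  ⨅ f ∈ admissibleWeights t E, ‖f‖ₑ

section DyadicCapacity

variable {t : ℝ} {E E' : Set ℝ}

theorem DyadicWeight.le_iff {f g : DyadicWeight} : f ≤ g ↔ ∀ i, f i ≤ g i := by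
  rw [← Lp.coeFn_le, EventuallyLE, Measure.ae_count_iff]

theorem DyadicWeight.add_apply (f g : DyadicWeight) (i : ℕ × ℤ) : (f + g) i = f i + g i :=
  Measure.ae_count_iff.1 (Lp.coeFn_add f g) i

theorem DyadicWeight.smul_apply (c : ℝ) (f : DyadicWeight) (i : ℕ × ℤ) : (c • f) i = c * f i :=
  Measure.ae_count_iff.1 (Lp.coeFn_smul c f) i

theorem DyadicWeight.nonneg_iff {f : DyadicWeight} : 0 ≤ f ↔ ∀ i, 0 ≤ f i := by
  rw [← Lp.coeFn_nonneg, EventuallyLE, Measure.ae_count_iff]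
  rfl

theorem DyadicWeight.tsum_ofReal_sq (f : DyadicWeight) :
    ∑' i, ENNReal.ofReal (f i ^ 2) = ‖f‖ₑ ^ 2 := by
  rw [Lp.enorm_def, eLpNorm_eq_lintegral_rpow_enorm_toReal two_ne_zero ENNReal.ofNat_ne_top,
    lintegral_count, ← ENNReal.rpow_natCast, ← ENNReal.rpow_mul]
  norm_num
  refine tsum_congr fun i => ?_
  rw [← sq_abs, ENNReal.ofReal_pow (abs_nonneg _), ← Real.enorm_eq_ofReal_abs]

theorem dyadicPotential_mono {f g : ℕ × ℤ → ℝ} (h : f ≤ g) (x : ℝ) :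
    dyadicPotential t f x ≤ dyadicPotential t g x := by
  refine ENNReal.tsum_le_tsum fun i => indicator_le_indicator ?_
  exact ENNReal.ofReal_le_ofReal (mul_le_mul_of_nonneg_left (h i) (by positivity))

theorem dyadicPotential_add {f g : ℕ × ℤ → ℝ} (hf : ∀ i, 0 ≤ f i) (hg : ∀ i, 0 ≤ g i) (x : ℝ) :
    dyadicPotential t (f + g) x = dyadicPotential t f x + dyadicPotential t g x := by
  simp only [dyadicPotential, ← ENNReal.tsum_add]
  refine tsum_congr fun i => ?_
  have := hf i
  have := hg i
  by_cases hx : x ∈ dyadicBall i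
  · simp only [indicator_of_mem hx, Pi.add_apply, mul_add]
    exact ENNReal.ofReal_add (by positivity) (by positivity)
  · simp [indicator_of_notMem hx]

theorem dyadicPotential_smul {c : ℝ} (hc : 0 ≤ c) (f : ℕ × ℤ → ℝ) (x : ℝ) :
    dyadicPotential t (c • f) x = ENNReal.ofReal c * dyadicPotential t f x := by
  simp only [dyadicPotential, ← ENNReal.tsum_mul_left]
  refine tsum_congr fun i => ?_
  by_cases hx : x ∈ dyadicBall i
  · simp only [indicator_of_mem hx, Pi.smul_apply, smul_eq_mul, ← ENNReal.ofReal_mul hc]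
    congr 1
    ring
  · simp [indicator_of_notMem hx]

theorem lowerSemicontinuous_dyadicPotential (f : ℕ × ℤ → ℝ) :
    LowerSemicontinuous (dyadicPotential t f) :=
  lowerSemicontinuous_tsum fun _ =>
    Metric.isOpen_ball.lowerSemicontinuous_indicator zero_le

theorem convex_admissibleWeights : Convex ℝ (admissibleWeights t E) := by
  rintro f ⟨hf, hfE⟩ g ⟨hg, hgE⟩ a b ha hb hab
  rw [DyadicWeight.nonneg_iff] at hf hg
  have e : ((a • f + b • g : DyadicWeight) : ℕ × ℤ → ℝ) = a • ⇑f + b • ⇑g := by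
    ext i
    rw [DyadicWeight.add_apply, DyadicWeight.smul_apply, DyadicWeight.smul_apply]
    rfl
  have hf' : ∀ i, 0 ≤ (a • ⇑f) i := fun i => mul_nonneg ha (hf i)
  have hg' : ∀ i, 0 ≤ (b • ⇑g) i := fun i => mul_nonneg hb (hg i)
  refine ⟨DyadicWeight.nonneg_iff.2 fun i => ?_, fun x hx => ?_⟩
  · rw [e]
    exact add_nonneg (hf' i) (hg' i)
  · rw [e, dyadicPotential_add hf' hg', dyadicPotential_smul ha, dyadicPotential_smul hb]
    calc (1 : ℝ≥0∞) = ENNReal.ofReal a * 1 + ENNReal.ofReal b * 1 := by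
          rw [mul_one, mul_one, ← ENNReal.ofReal_add ha hb, hab, ENNReal.ofReal_one]
      _ ≤ _ := by
          gcongr
          exacts [hfE x hx, hgE x hx]

theorem admissibleWeights_anti (h : E ⊆ E') : admissibleWeights t E' ⊆ admissibleWeights t E :=
  fun _ hf => ⟨hf.1, fun x hx => hf.2 x (h hx)⟩

theorem dyadicCapacity_le {f : DyadicWeight} (hf : f ∈ admissibleWeights t E) :
    dyadicCapacity t E ≤ ‖f‖ₑ :=
  iInf₂_le f hf

theorem exists_admissible_of_dyadicCapacity_lt {c : ℝ≥0∞} (h : dyadicCapacity t E < c) :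
    ∃ f ∈ admissibleWeights t E, ‖f‖ₑ < c := by
  simpa [dyadicCapacity, iInf_lt_iff] using h

theorem dyadicCapacity_mono : Monotone (dyadicCapacity t) := fun _ _ h =>
  le_iInf₂ fun _ hf => dyadicCapacity_le (admissibleWeights_anti h hf)

theorem dyadicCapacity_empty : dyadicCapacity t ∅ = 0 := by
  have : (0 : DyadicWeight) ∈ admissibleWeights t ∅ := ⟨le_rfl, by simp⟩
  simpa using dyadicCapacity_le this

theorem dyadicCapacity_union_le :
    dyadicCapacity t (E ∪ E') ≤ dyadicCapacity t E + dyadicCapacity t E' := by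
  refine ENNReal.le_of_forall_pos_le_add fun ε hε hlt => ?_
  have hE := ENNReal.add_lt_top.1 hlt
  have hε' : (ε / 2 : ℝ≥0∞) ≠ 0 := by simpa using hε.ne'
  obtain ⟨f, hf, hfc⟩ := exists_admissible_of_dyadicCapacity_lt
    (ENNReal.lt_add_right hE.1.ne hε')
  obtain ⟨g, hg, hgc⟩ := exists_admissible_of_dyadicCapacity_lt
    (ENNReal.lt_add_right hE.2.ne hε')
  have hfg : f + g ∈ admissibleWeights t (E ∪ E') := by
    refine ⟨add_nonneg hf.1 hg.1, fun x hx => ?_⟩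
    rcases hx with hx | hx
    · exact (hf.2 x hx).trans (dyadicPotential_mono
        (DyadicWeight.le_iff.1 (le_add_of_nonneg_right hg.1)) x)
    · exact (hg.2 x hx).trans (dyadicPotential_mono
        (DyadicWeight.le_iff.1 (le_add_of_nonneg_left hf.1)) x)
  calc _ ≤ ‖f + g‖ₑ := dyadicCapacity_le hfg
    _ ≤ ‖f‖ₑ + ‖g‖ₑ := enorm_add_le _ _
    _ ≤ _ := add_le_add hfc.le hgc.le
    _ = _ := by rw [add_add_add_comm, ENNReal.add_halves]

theorem dyadicCapacity_iUnion_le {E : ℕ → Set ℝ} (hE : Monotone E) :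
    dyadicCapacity t (⋃ n, E n) ≤ ⨆ n, dyadicCapacity t (E n) := by
  refine ENNReal.le_of_forall_pos_le_add fun ε hε hlt => ?_
  set c := ⨆ n, dyadicCapacity t (E n)
  have hε' : (0 : ℝ) < ε / 2 := by positivity
  obtain ⟨g, hgc, hg⟩ := exists_norm_le_forall_exists_le_of_antitone_convex
    (C := fun n => admissibleWeights t (E n)) (fun m n h => admissibleWeights_anti (hE h))
    (fun n => convex_admissibleWeights) (c := c.toReal + ε / 2) (fun n => by
      obtain ⟨f, hf, hfc⟩ := exists_admissible_of_dyadicCapacity_lt (t := t) (E := E n)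
        (c := ENNReal.ofReal (c.toReal + ε / 2)) (by
          refine (le_iSup (fun n => dyadicCapacity t (E n)) n).trans_lt ?_
          exact (ENNReal.lt_ofReal_iff_toReal_lt hlt.ne).2 (by linarith))
      refine ⟨f, hf, ?_⟩
      rw [← ofReal_norm, ENNReal.ofReal_lt_ofReal_iff (by positivity)] at hfc
      exact hfc.le) hε'
  have hg' : g ∈ admissibleWeights t (⋃ n, E n) := by
    refine ⟨?_, fun x hx => ?_⟩
    · obtain ⟨f, hf, hfg⟩ := hg 0
      exact hf.1.trans hfg
    · obtain ⟨n, hn⟩ := mem_iUnion.1 hx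
      obtain ⟨f, hf, hfg⟩ := hg n
      exact (hf.2 x hn).trans (dyadicPotential_mono (DyadicWeight.le_iff.1 hfg) x)
  calc _ ≤ ‖g‖ₑ := dyadicCapacity_le hg'
    _ = ENNReal.ofReal ‖g‖ := (ofReal_norm g).symm
    _ ≤ ENNReal.ofReal (c.toReal + ε) := ENNReal.ofReal_le_ofReal (by linarith)
    _ = c + ε := by
      rw [ENNReal.ofReal_add (by positivity) (by positivity), ENNReal.ofReal_toReal hlt.ne,
        ENNReal.ofReal_coe_nnreal]

theorem exists_isOpen_dyadicCapacity_lt {c : ℝ≥0∞} (h : dyadicCapacity t E < c) :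
    ∃ U, IsOpen U ∧ E ⊆ U ∧ dyadicCapacity t U < c := by
  obtain ⟨f, hf, hfc⟩ := exists_admissible_of_dyadicCapacity_lt h
  obtain ⟨b, hb, hb1⟩ : ∃ b : ℝ, ENNReal.ofReal b * ‖f‖ₑ < c ∧ 1 < b := by
    have hcont : Tendsto (fun b : ℝ => ENNReal.ofReal b * ‖f‖ₑ) (𝓝[>] 1)
        (𝓝 (ENNReal.ofReal 1 * ‖f‖ₑ)) :=
      (ENNReal.Tendsto.mul_const (ENNReal.tendsto_ofReal tendsto_id)
        (Or.inr enorm_ne_top)).mono_left nhdsWithin_le_nhds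
    exact ((hcont.eventually_lt_const (by simpa using hfc)).and self_mem_nhdsWithin).exists
  have hb0 : 0 ≤ b := by linarith
  have e : ((b • f : DyadicWeight) : ℕ × ℤ → ℝ) = b • ⇑f := by
    ext i
    simp [DyadicWeight.smul_apply]
  refine ⟨dyadicPotential t (b • ⇑f) ⁻¹' Ioi 1,
    (lowerSemicontinuous_dyadicPotential _).isOpen_preimage 1, fun x hx => ?_, ?_⟩
  · rw [mem_preimage, dyadicPotential_smul hb0, mem_Ioi]
    calc (1 : ℝ≥0∞) < ENNReal.ofReal b := by simpa using hb1
      _ = ENNReal.ofReal b * 1 := (mul_one _).symm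
      _ ≤ _ := by gcongr; exact hf.2 x hx
  · refine (dyadicCapacity_le (f := b • f) ⟨?_, fun x hx => ?_⟩).trans_lt ?_
    · rw [DyadicWeight.nonneg_iff, e]
      exact fun i => mul_nonneg hb0 (DyadicWeight.nonneg_iff.1 hf.1 i)
    · rw [e]
      exact le_of_lt hx
    · rwa [enorm_smul, Real.enorm_eq_ofReal hb0]

theorem dyadicCapacity_Ioc_le (ht : 0 ≤ t) {x y : ℝ} (hxy : x < y) (hxy' : y - x ≤ 1) :
    dyadicCapacity t (Ioc x y) ≤ ENNReal.ofReal ((2 * (y - x)) ^ t) := by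
  obtain ⟨n, hn, hn'⟩ := exists_nat_pow_near_of_lt_one (sub_pos.2 hxy) hxy'
    (y := (1 / 2 : ℝ)) (by norm_num) (by norm_num)
  let i : ℕ × ℤ := (n, ⌊x * 2 ^ n⌋ + 1)
  have hμ : (Measure.count : Measure (ℕ × ℤ)) {i} ≠ ∞ := by simp
  let f : DyadicWeight :=
    indicatorConstLp 2 (measurableSet_singleton i) hμ ((2 : ℝ) ^ (-(t * n)))
  have hfi : f i = 2 ^ (-(t * n)) := Measure.ae_count_iff.1 indicatorConstLp_coeFn_mem i rfl
  have hfj : ∀ j, f j = ({i} : Set (ℕ × ℤ)).indicator (fun _ => (2 : ℝ) ^ (-(t * n))) j :=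
    Measure.ae_count_iff.1 indicatorConstLp_coeFn
  have h2n : (0 : ℝ) < 2 ^ n := by positivity
  have hf : f ∈ admissibleWeights t (Ioc x y) := by
    refine ⟨DyadicWeight.nonneg_iff.2 fun j => ?_, fun z hz => ?_⟩
    · rw [hfj]
      exact indicator_nonneg (fun _ _ => by positivity) _
    · have hzi : z ∈ dyadicBall i := by
        have h1 := Int.floor_le (x * 2 ^ n)
        have h2 := Int.lt_floor_add_one (x * 2 ^ n)
        have h3 : (y - x) * 2 ^ n ≤ 1 := by
          rwa [one_div_pow, le_div_iff₀ h2n] at hn'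
        have h4 := mul_lt_mul_of_pos_right hz.1 h2n
        have h5 := mul_le_mul_of_nonneg_right hz.2 h2n.le
        rw [dyadicBall, Real.ball_eq_Ioo, one_div_pow, ← sub_div, ← add_div]
        simp only [i, mem_Ioo, div_lt_iff₀ h2n, lt_div_iff₀ h2n]
        push_cast
        constructor <;> linarith
      refine le_trans ?_ (ENNReal.le_tsum i)
      rw [indicator_of_mem hzi, hfi, ← Real.rpow_add two_pos]
      simp [i]
  refine (dyadicCapacity_le hf).trans ?_
  rw [← ofReal_norm, norm_indicatorConstLp two_ne_zero ENNReal.ofNat_ne_top]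
  simp only [measureReal_def, Measure.count_singleton, ENNReal.toReal_one, Real.one_rpow, mul_one]
  refine ENNReal.ofReal_le_ofReal ?_
  rw [Real.norm_of_nonneg (by positivity), Real.rpow_neg zero_le_two, mul_comm,
    Real.rpow_natCast_mul zero_le_two, ← Real.inv_rpow h2n.le]
  refine Real.rpow_le_rpow (by positivity) ?_ ht
  rw [pow_succ, one_div_pow, one_div] at hn
  linarith

theorem dyadicCapacity_lt_top_of_isCompact (ht : 0 ≤ t) (hE : IsCompact E) :
    dyadicCapacity t E < ∞ := by
  refine hE.induction_on (p := fun E => dyadicCapacity t E < ∞) ?_ ?_ ?_ ?_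
  · simp [dyadicCapacity_empty]
  · exact fun s s' h h' => (dyadicCapacity_mono h).trans_lt h'
  · exact fun s s' h h' => dyadicCapacity_union_le.trans_lt (ENNReal.add_lt_top.2 ⟨h, h'⟩)
  · intro x _
    refine ⟨Ioc (x - 1 / 2) (x + 1 / 2), mem_nhdsWithin_of_mem_nhds
      (Ioc_mem_nhds (by linarith) (by linarith)), ?_⟩
    exact (dyadicCapacity_Ioc_le ht (by linarith) (by linarith)).trans_lt ENNReal.ofReal_lt_top

theorem eq_floor_or_eq_floor_add_one_of_mem_dyadicBall {x : ℝ} {i : ℕ × ℤ}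
    (hx : x ∈ dyadicBall i) : i.2 = ⌊x * 2 ^ i.1⌋ ∨ i.2 = ⌊x * 2 ^ i.1⌋ + 1 := by
  have h2n : (0 : ℝ) < 2 ^ i.1 := by positivity
  rw [dyadicBall, Real.ball_eq_Ioo, one_div_pow, ← sub_div, ← add_div, mem_Ioo,
    div_lt_iff₀ h2n, lt_div_iff₀ h2n] at hx
  have h1 := Int.floor_le (x * 2 ^ i.1)
  have h2 := Int.lt_floor_add_one (x * 2 ^ i.1)
  have h3 : ((i.2 : ℤ) : ℝ) < (⌊x * 2 ^ i.1⌋ + 2 : ℤ) := by push_cast; linarith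
  have h4 : ((⌊x * 2 ^ i.1⌋ - 1 : ℤ) : ℝ) < (i.2 : ℤ) := by push_cast; linarith
  rw [Int.cast_lt] at h3 h4
  omega

/-- If the potential at `x` is at least one, some interval of the grid containing `x` carries a
large weight. -/
theorem exists_mem_dyadicBall_of_one_le_dyadicPotential (ht : 0 < t) {f : ℕ × ℤ → ℝ} {x : ℝ}
    (h : 1 ≤ dyadicPotential t f x) :
    ∃ i, x ∈ dyadicBall i ∧ (1 - 2 ^ (-t)) / 4 * (2 ^ (-t)) ^ i.1 ≤ 2 ^ (t * i.1) * f i := by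
  by_contra! hno
  set q : ℝ := 2 ^ (-t)
  have hq : 0 ≤ q := by positivity
  have hq1 : q < 1 := Real.rpow_lt_one_of_one_lt_of_neg one_lt_two (by linarith)
  have hq1' : 0 < 1 - q := by linarith
  have hinner : ∀ n : ℕ, ∑' k : ℤ, (dyadicBall (n, k)).indicator
      (fun _ => ENNReal.ofReal (2 ^ (t * n) * f (n, k))) x ≤
        ENNReal.ofReal ((1 - q) / 2 * q ^ n) := by
    intro n
    rw [tsum_eq_sum (s := {⌊x * 2 ^ n⌋, ⌊x * 2 ^ n⌋ + 1})]
    · refine (Finset.sum_le_card_nsmul _ _ (ENNReal.ofReal ((1 - q) / 4 * q ^ n)) ?_).trans ?_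
      · intro k _
        exact indicator_apply_le' (fun hx => ENNReal.ofReal_le_ofReal (hno (n, k) hx).le)
          fun _ => zero_le
      · rw [Finset.card_pair (by simp), nsmul_eq_mul, Nat.cast_ofNat,
          ← ENNReal.ofReal_ofNat, ← ENNReal.ofReal_mul zero_le_two]
        exact ENNReal.ofReal_le_ofReal (by linarith)
    · intro k hk
      refine indicator_of_notMem (fun hx => hk ?_) _
      simpa using eq_floor_or_eq_floor_add_one_of_mem_dyadicBall hx
  have hle : dyadicPotential t f x ≤ ENNReal.ofReal (1 / 2) := by
    rw [dyadicPotential, ENNReal.tsum_prod']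
    refine (ENNReal.tsum_le_tsum hinner).trans ?_
    rw [← ENNReal.ofReal_tsum_of_nonneg (fun n => by positivity)
      ((summable_geometric_of_lt_one hq hq1).mul_left _), tsum_mul_left,
      tsum_geometric_of_lt_one hq hq1]
    refine ENNReal.ofReal_le_ofReal ?_
    field_simp
    rfl
  have := h.trans hle
  rw [ENNReal.one_le_ofReal] at this
  norm_num at this

/-- Sets of capacity zero have Hausdorff measure zero, in the appropriate dimension. -/
theorem hausdorffMeasure_eq_zero_of_dyadicCapacity_eq_zero (ht : 0 < t)
    (h : dyadicCapacity t E = 0) : μH[4 * t] E = 0 := by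
  set κ : ℝ := (1 - 2 ^ (-t)) / 4
  have hκ : 0 < κ := by
    have : (2 : ℝ) ^ (-t) < 1 := Real.rpow_lt_one_of_one_lt_of_neg one_lt_two (by linarith)
    simp only [κ]
    linarith
  set B : ℝ := 2 ^ (4 * t) / κ ^ 2
  have hB : 0 ≤ B := by positivity
  have h4t : 0 < 4 * t := by linarith
  let e : ℕ → ℝ≥0∞ := fun m => (m : ℝ≥0∞)⁻¹
  have he : Tendsto (fun m => ENNReal.ofReal B * e m ^ 2) atTop (𝓝 0) := by
    have := ENNReal.Tendsto.const_mul (a := ENNReal.ofReal B)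
      ((ENNReal.continuous_pow 2).tendsto 0 |>.comp ENNReal.tendsto_inv_nat_nhds_zero)
      (Or.inr ENNReal.ofReal_ne_top)
    simpa [e] using this
  have hex : ∀ m : ℕ, ∃ f ∈ admissibleWeights t E, ‖f‖ₑ < e m := fun m =>
    exists_admissible_of_dyadicCapacity_lt (by simp [h, e])
  choose f hf hfe using hex
  let I : ℕ → Set (ℕ × ℤ) := fun m => {i | κ * (2 ^ (-t)) ^ i.1 ≤ 2 ^ (t * i.1) * f m i}
  have hdiam : ∀ m, ∀ i : I m,
      Metric.ediam (dyadicBall i) ^ (4 * t) ≤ ENNReal.ofReal B * ENNReal.ofReal (f m i ^ 2) := by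
    rintro m ⟨⟨n, k⟩, hi⟩
    simp only [I, mem_ofPred_eq] at hi
    rw [dyadicBall, Real.ball_eq_Ioo, Real.ediam_Ioo, ENNReal.ofReal_rpow_of_nonneg _ h4t.le,
      ← ENNReal.ofReal_mul hB]
    · refine ENNReal.ofReal_le_ofReal ?_
      have e1 : ((2 : ℝ) ^ (-t)) ^ n = 2 ^ (-(t * n)) := by
        rw [← Real.rpow_mul_natCast zero_le_two]
        ring_nf
      have e2 : κ * 2 ^ (-(2 * t * n)) ≤ f m (n, k) := by
        have h0 : (0 : ℝ) < 2 ^ (t * n) := by positivity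
        rw [e1] at hi
        refine le_of_mul_le_mul_left (le_of_eq_of_le ?_ hi) h0
        rw [mul_left_comm, ← Real.rpow_add two_pos]
        ring_nf
      have e3 := pow_le_pow_left₀ (by positivity) e2 2
      have e4 : ((2 : ℝ) ^ (-(2 * t * n))) ^ 2 = ((1 / 2) ^ n) ^ (4 * t) := by
        rw [← Real.rpow_mul_natCast zero_le_two, one_div, inv_pow, Real.inv_rpow (by positivity),
          ← Real.rpow_natCast_mul zero_le_two, ← Real.rpow_neg zero_le_two]
        push_cast
        ring_nf
      calc _ = 2 ^ (4 * t) * ((1 / 2 : ℝ) ^ n) ^ (4 * t) := by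
            rw [← Real.mul_rpow zero_le_two (by positivity)]
            ring_nf
        _ = B * (κ * 2 ^ (-(2 * t * n))) ^ 2 := by
            rw [mul_pow, e4]
            simp only [B]
            field_simp
        _ ≤ _ := mul_le_mul_of_nonneg_left e3 hB
    · have : (0 : ℝ) < (1 / 2) ^ n := by positivity
      simp only
      linarith
  have htsum : ∀ m, ∑' i : I m, Metric.ediam (dyadicBall i) ^ (4 * t) ≤
      ENNReal.ofReal B * e m ^ 2 := by
    intro m
    calc _ ≤ ∑' i : I m, ENNReal.ofReal B * ENNReal.ofReal (f m i ^ 2) :=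
          ENNReal.tsum_le_tsum (hdiam m)
      _ = ENNReal.ofReal B * ∑' i : I m, ENNReal.ofReal (f m i ^ 2) := ENNReal.tsum_mul_left
      _ ≤ ENNReal.ofReal B * ∑' i, ENNReal.ofReal (f m i ^ 2) := by
          gcongr
          exact ENNReal.tsum_comp_le_tsum_of_injective Subtype.val_injective _
      _ ≤ _ := by
          rw [DyadicWeight.tsum_ofReal_sq]
          gcongr
          exact (hfe m).le
  have hr : Tendsto (fun m => (ENNReal.ofReal B * e m ^ 2) ^ (4 * t)⁻¹) atTop (𝓝 0) := by
    have := (ENNReal.continuous_rpow_const (y := (4 * t)⁻¹)).tendsto 0 |>.comp he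
    rwa [ENNReal.zero_rpow_of_pos (by positivity)] at this
  refine le_antisymm ?_ zero_le
  refine (Measure.hausdorffMeasure_le_liminf_tsum (4 * t) E _ hr
    (fun m (i : I m) => dyadicBall i) (Eventually.of_forall fun m i => ?_)
    (Eventually.of_forall fun m x hx => ?_)).trans ?_
  · rw [ENNReal.le_rpow_inv_iff h4t]
    exact (ENNReal.le_tsum i).trans (htsum m)
  · obtain ⟨i, hi, hi'⟩ := exists_mem_dyadicBall_of_one_le_dyadicPotential ht ((hf m).2 x hx)
    exact mem_iUnion.2 ⟨⟨i, hi'⟩, hi⟩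
  · rw [← he.liminf_eq]
    exact liminf_le_liminf (Eventually.of_forall htsum)

/-- **Frostman's lemma** for compact subsets of the line of positive capacity. -/
theorem exists_frostman_of_isCompact (ht : 0 < t) (hE : IsCompact E)
    (hpos : dyadicCapacity t E ≠ 0) :
    ∃ ν : Measure ℝ, IsProbabilityMeasure ν ∧ ν Eᶜ = 0 ∧ ∃ M : ℝ, 0 ≤ M ∧
      ∀ x r, 0 < r → ν (Metric.closedBall x r) ≤ ENNReal.ofReal (M * r ^ t) := by
  have hfin : ∀ S ⊆ E, dyadicCapacity t S ≠ ∞ := fun S hS =>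
    ((dyadicCapacity_mono hS).trans_lt (dyadicCapacity_lt_top_of_isCompact ht.le hE)).ne
  let F : ℝ → ℝ := fun x => (dyadicCapacity t (E ∩ Iic x)).toReal
  have hmono : Monotone F := fun x y hxy => ENNReal.toReal_mono (hfin _ inter_subset_left)
    (dyadicCapacity_mono (inter_subset_inter_right _ (Iic_subset_Iic.2 hxy)))
  have hF : ∀ x y, x < y → y - x ≤ 1 → F y ≤ F x + (2 * (y - x)) ^ t := by
    intro x y hxy hxy'
    have hsub : E ∩ Iic y ⊆ (E ∩ Iic x) ∪ Ioc x y := by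
      rintro z ⟨hz, hzy⟩
      rcases le_or_gt z x with h | h
      · exact Or.inl ⟨hz, h⟩
      · exact Or.inr ⟨h, hzy⟩
    have hle := (dyadicCapacity_mono (t := t) hsub).trans (dyadicCapacity_union_le.trans
      (add_le_add le_rfl (dyadicCapacity_Ioc_le ht.le hxy hxy')))
    have h0 : 0 ≤ (2 * (y - x)) ^ t := Real.rpow_nonneg (by linarith) _
    refine (ENNReal.toReal_mono (by simp [hfin _ inter_subset_left]) hle).trans_eq ?_
    rw [ENNReal.toReal_add (hfin _ inter_subset_left) ENNReal.ofReal_ne_top,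
      ENNReal.toReal_ofReal h0]
  have hcont : ∀ x, ContinuousWithinAt F (Ici x) x := by
    intro x
    rw [← continuousWithinAt_Ioi_iff_Ici]
    have hlim : Tendsto (fun y => F x + (2 * (y - x)) ^ t) (𝓝[>] x) (𝓝 (F x)) := by
      have : ContinuousAt (fun y => F x + (2 * (y - x)) ^ t) x := by
        refine continuousAt_const.add (ContinuousAt.rpow_const (by fun_prop) (Or.inr ht.le))
      simpa [ContinuousAt, Real.zero_rpow ht.ne'] using this.tendsto.mono_left nhdsWithin_le_nhds
    refine tendsto_of_tendsto_of_tendsto_of_le_of_le' tendsto_const_nhds hlim ?_ ?_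
    · filter_upwards [self_mem_nhdsWithin] with y hy
      exact hmono (le_of_lt hy)
    · filter_upwards [Ioc_mem_nhdsGT (show x < x + 1 by linarith)] with y hy
      exact hF x y hy.1 (by linarith [hy.2])
  let G : StieltjesFunction ℝ := ⟨F, hmono, hcont⟩
  have hG : ∀ x, G x = F x := fun _ => rfl
  have hcompl : G.measure Eᶜ = 0 := by
    refine measure_null_of_locally_null _ fun x hx => ?_
    obtain ⟨ε, hε, hball⟩ := Metric.isOpen_iff.1 hE.isClosed.isOpen_compl x hx
    refine ⟨Ioc (x - ε / 2) (x + ε / 2), mem_nhdsWithin_of_mem_nhds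
      (Ioc_mem_nhds (by linarith) (by linarith)), ?_⟩
    have heq : E ∩ Iic (x + ε / 2) = E ∩ Iic (x - ε / 2) := by
      refine Subset.antisymm ?_ (inter_subset_inter_right _ (Iic_subset_Iic.2 (by linarith)))
      rintro z ⟨hz, hzx⟩
      refine ⟨hz, ?_⟩
      by_contra hlt
      rw [mem_Iic, not_le] at hlt
      rw [mem_Iic] at hzx
      refine hball ?_ hz
      rw [Real.ball_eq_Ioo]
      constructor <;> linarith
    rw [StieltjesFunction.measure_Ioc, hG, hG]
    simp [F, heq]
  have hE0 : G.measure E ≠ 0 := by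
    intro h0
    obtain ⟨R, hR⟩ := hE.isBounded.subset_closedBall 0
    rw [Real.closedBall_eq_Icc] at hR
    have huniv : G.measure univ = 0 := by
      rw [← union_compl_self E]
      exact measure_union_null h0 hcompl
    have hI : G.measure (Ioc (0 - R - 1) (0 + R)) = 0 := measure_mono_null (subset_univ _) huniv
    have e1 : E ∩ Iic (0 - R - 1) = ∅ := by
      ext z
      simp only [mem_inter_iff, mem_Iic, mem_empty_iff_false, iff_false, not_and, not_le]
      exact fun hz => by linarith [(hR hz).1]
    have e2 : E ∩ Iic (0 + R) = E := inter_eq_left.2 fun z hz => (hR hz).2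
    rw [StieltjesFunction.measure_Ioc, hG, hG] at hI
    simp only [F, e1, e2, dyadicCapacity_empty, ENNReal.toReal_zero, sub_zero,
      ENNReal.ofReal_eq_zero] at hI
    exact (ENNReal.toReal_pos hpos (hfin _ subset_rfl)).not_ge hI
  have hEtop : G.measure E ≠ ∞ := hE.measure_lt_top.ne
  have hprob := ProbabilityTheory.cond_isProbabilityMeasure_of_finite hE0 hEtop
  refine ⟨ProbabilityTheory.cond G.measure E, hprob, ?_,
    3 ^ t + ((G.measure E)⁻¹).toReal * 6 ^ t, by positivity, fun x r hr => ?_⟩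
  · rw [ProbabilityTheory.cond_apply hE.measurableSet]
    simp
  · rcases le_or_gt (3 * r) 1 with h | h
    · calc _ ≤ (G.measure E)⁻¹ * G.measure (Ioc (x - 2 * r) (x + r)) := by
            rw [ProbabilityTheory.cond_apply hE.measurableSet]
            gcongr
            refine inter_subset_right.trans ?_
            rw [Real.closedBall_eq_Icc]
            exact fun z hz => ⟨by linarith [hz.1], hz.2⟩
        _ ≤ (G.measure E)⁻¹ * ENNReal.ofReal ((6 * r) ^ t) := by
            rw [StieltjesFunction.measure_Ioc, hG, hG]
            gcongr
            have := hF (x - 2 * r) (x + r) (by linarith) (by linarith)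
            rw [show 2 * (x + r - (x - 2 * r)) = 6 * r by ring] at this
            linarith
        _ = ENNReal.ofReal (((G.measure E)⁻¹).toReal * (6 * r) ^ t) := by
            rw [ENNReal.ofReal_mul (by positivity), ENNReal.ofReal_toReal (by simpa using hE0)]
        _ ≤ _ := by
            refine ENNReal.ofReal_le_ofReal ?_
            rw [Real.mul_rpow (by norm_num) hr.le, add_mul, mul_assoc]
            have : 0 ≤ (3 : ℝ) ^ t * r ^ t := by positivity
            linarith
    · refine prob_le_one.trans ?_
      rw [ENNReal.one_le_ofReal, add_mul, ← Real.mul_rpow (by norm_num) hr.le]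
      have h1 : 1 ≤ (3 * r) ^ t := Real.one_le_rpow h.le ht.le
      have : 0 ≤ ((G.measure E)⁻¹).toReal * 6 ^ t * r ^ t := by positivity
      linarith

end DyadicCapacity

/-- A form of **Frostman's lemma**: a Borel subset of the line of Hausdorff dimension greater
than `s` carries a probability measure satisfying a Frostman condition of exponent `s / 4`. -/
theorem exists_frostman_of_lt_dimH {A : Set ℝ} (hA : MeasurableSet A) {s : ℝ≥0} (hs : 0 < s)
    (hsA : s < dimH A) :
    ∃ ν : Measure ℝ, IsProbabilityMeasure ν ∧ ν Aᶜ = 0 ∧ ∃ M : ℝ, 0 ≤ M ∧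
      ∀ x r, 0 < r → ν (Metric.closedBall x r) ≤ ENNReal.ofReal (M * r ^ (s / 4 : ℝ)) := by
  have ht : (0 : ℝ) < s / 4 := by positivity
  have hcap : dyadicCapacity (s / 4 : ℝ) A ≠ 0 := by
    intro h
    have h0 := hausdorffMeasure_eq_zero_of_dyadicCapacity_eq_zero ht h
    rw [mul_div_cancel₀ _ (by norm_num), hausdorffMeasure_of_lt_dimH hsA] at h0
    exact ENNReal.top_ne_zero h0
  obtain ⟨c, hc0, hc⟩ := exists_between (pos_iff_ne_zero.2 hcap)
  obtain ⟨C, hCA, hC, hcC⟩ := hA.analyticSet.exists_isCompact_le dyadicCapacity_mono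
    (fun _ => dyadicCapacity_iUnion_le) (fun _ _ _ => exists_isOpen_dyadicCapacity_lt) hc
  obtain ⟨ν, hν, hνC, hM⟩ := exists_frostman_of_isCompact ht hC (hc0.trans_le hcC).ne'
  exact ⟨ν, hν, measure_mono_null (compl_subset_compl.2 hCA) hνC, hM⟩

/-- A product with a probability measure is bounded by a uniform bound for the slices. -/
theorem MeasureTheory.Measure.prod_le_of_slices {α β : Type*} [MeasurableSpace α]
    [MeasurableSpace β] (μ : Measure α) (ν : Measure β) [IsProbabilityMeasure μ] [SFinite ν]
    {s : Set (α × β)} (hs : MeasurableSet s) {c : ℝ≥0∞}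
    (h : ∀ x, ν (Prod.mk x ⁻¹' s) ≤ c) : μ.prod ν s ≤ c := by
  rw [Measure.prod_apply hs]
  exact (lintegral_mono h).trans (by simp)

theorem measurable_triArea :
    Measurable fun q : (ℝ × ℝ) × (ℝ × ℝ) × (ℝ × ℝ) => triArea q.1 q.2.1 q.2.2 := by
  unfold triArea
  fun_prop

/-- Two points whose first coordinates are at distance more than `d` span small triangles only
with the third points in a thin strip, whose vertical sections are short. -/
theorem setOf_triArea_lt_subset_closedBall {p₁ p₂ : ℝ × ℝ} {d r : ℝ} (hd : 0 < d)
    (h : d < |p₂.1 - p₁.1|) (x : ℝ) :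
    {y | triArea p₁ p₂ (x, y) < r} ⊆
      Metric.closedBall (p₁.2 + (p₂.2 - p₁.2) * (x - p₁.1) / (p₂.1 - p₁.1)) (2 * r / d) := by
  intro y hy
  simp only [triArea, mem_ofPred_eq] at hy
  have hne : p₂.1 - p₁.1 ≠ 0 := abs_pos.1 (hd.trans h)
  rw [Metric.mem_closedBall, Real.dist_eq, le_div_iff₀ hd]
  have e : (p₂.1 - p₁.1) * (y - p₁.2) - (p₂.2 - p₁.2) * (x - p₁.1) =
      (p₂.1 - p₁.1) * (y - (p₁.2 + (p₂.2 - p₁.2) * (x - p₁.1) / (p₂.1 - p₁.1))) := by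
    field_simp
    ring
  rw [e, abs_mul] at hy
  have := mul_le_mul_of_nonneg_right h.le
    (abs_nonneg (y - (p₁.2 + (p₂.2 - p₁.2) * (x - p₁.1) / (p₂.1 - p₁.1))))
  linarith

/-- The product of two probability measures on the line satisfying a Frostman condition gives
small mass to the triples spanning a triangle of small area. -/
theorem prod_triArea_lt_le {μ₁ μ₂ : Measure ℝ} [IsProbabilityMeasure μ₁] [IsProbabilityMeasure μ₂]
    {M₁ M₂ t : ℝ} (hM₁ : 0 ≤ M₁) (hM₂ : 0 ≤ M₂)
    (h₁ : ∀ x r, 0 < r → μ₁ (Metric.closedBall x r) ≤ ENNReal.ofReal (M₁ * r ^ t))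
    (h₂ : ∀ x r, 0 < r → μ₂ (Metric.closedBall x r) ≤ ENNReal.ofReal (M₂ * r ^ t))
    {r : ℝ} (hr : 0 < r) :
    ((μ₁.prod μ₂).prod ((μ₁.prod μ₂).prod (μ₁.prod μ₂)))
        {q : (ℝ × ℝ) × (ℝ × ℝ) × (ℝ × ℝ) | triArea q.1 q.2.1 q.2.2 < r}
      ≤ ENNReal.ofReal ((M₁ + M₂ * 2 ^ t) * r ^ (t / 2)) := by
  have hsq : 0 < √r := Real.sqrt_pos.2 hr
  have hpow : √r ^ t = r ^ (t / 2) := by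
    rw [Real.sqrt_eq_rpow, ← Real.rpow_mul hr.le]
    ring_nf
  let A : Set ((ℝ × ℝ) × (ℝ × ℝ) × (ℝ × ℝ)) := {q | |q.2.1.1 - q.1.1| ≤ √r}
  let B : Set ((ℝ × ℝ) × (ℝ × ℝ) × (ℝ × ℝ)) :=
    {q | √r < |q.2.1.1 - q.1.1|} ∩ {q | triArea q.1 q.2.1 q.2.2 < r}
  have hA : MeasurableSet A := measurableSet_le (by fun_prop) (by fun_prop)
  have hB : MeasurableSet B :=
    (measurableSet_lt (by fun_prop) (by fun_prop)).inter
      (measurableSet_lt measurable_triArea (by fun_prop))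
  have hAB : {q : (ℝ × ℝ) × (ℝ × ℝ) × (ℝ × ℝ) | triArea q.1 q.2.1 q.2.2 < r} ⊆ A ∪ B := by
    intro q hq
    rcases le_or_gt |q.2.1.1 - q.1.1| (√r) with h | h
    · exact Or.inl h
    · exact Or.inr ⟨h, hq⟩
  have bA : ((μ₁.prod μ₂).prod ((μ₁.prod μ₂).prod (μ₁.prod μ₂))) A ≤
      ENNReal.ofReal (M₁ * r ^ (t / 2)) := by
    refine Measure.prod_le_of_slices _ _ hA fun p₁ => ?_
    have e : Prod.mk p₁ ⁻¹' A = (Metric.closedBall p₁.1 (√r) ×ˢ univ) ×ˢ univ := by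
      ext q
      simp [A, Real.dist_eq]
    rw [e, Measure.prod_prod, Measure.prod_prod, measure_univ, measure_univ, mul_one, mul_one,
      ← hpow]
    exact h₁ _ _ hsq
  have bB : ((μ₁.prod μ₂).prod ((μ₁.prod μ₂).prod (μ₁.prod μ₂))) B ≤
      ENNReal.ofReal (M₂ * 2 ^ t * r ^ (t / 2)) := by
    refine Measure.prod_le_of_slices _ _ hB fun p₁ => ?_
    refine Measure.prod_le_of_slices _ _ (measurable_prodMk_left hB) fun p₂ => ?_
    refine Measure.prod_le_of_slices _ _
      (measurable_prodMk_left (measurable_prodMk_left hB)) fun x => ?_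
    by_cases h : √r < |p₂.1 - p₁.1|
    · refine (measure_mono (subset_trans ?_
        (setOf_triArea_lt_subset_closedBall (r := r) hsq h x))).trans
          ((h₂ _ _ (by positivity)).trans_eq ?_)
      · exact fun y hy => hy.2
      · rw [mul_div_assoc, Real.div_sqrt, Real.mul_rpow zero_le_two hsq.le, hpow, mul_assoc]
    · have : Prod.mk x ⁻¹' (Prod.mk p₂ ⁻¹' (Prod.mk p₁ ⁻¹' B)) = ∅ := by
        ext y
        simp [B, h]
      simp [this]
  calc _ ≤ _ := measure_mono hAB
    _ ≤ _ := measure_union_le _ _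
    _ ≤ _ := add_le_add bA bB
    _ = _ := by
      rw [← ENNReal.ofReal_add (by positivity) (by positivity)]
      ring_nf

/-- If `K₁, K₂ ⊆ ℝ` are Borel sets of positive Hausdorff dimension, then
the Cartesian product `K₁ × K₂ ⊆ ℝ²` is curved. -/
theorem isCurved_prod (K₁ K₂ : Set ℝ) (h₁ : MeasurableSet K₁) (h₂ : MeasurableSet K₂)
    (hd₁ : 0 < dimH K₁) (hd₂ : 0 < dimH K₂) :
    IsCurved (K₁ ×ˢ K₂) := by
  obtain ⟨s, hs, hsK⟩ := ENNReal.lt_iff_exists_nnreal_btwn.1 (lt_min hd₁ hd₂)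
  have hs0 : 0 < s := by exact_mod_cast hs
  obtain ⟨μ₁, hμ₁, hK₁, M₁, hM₁, hb₁⟩ :=
    exists_frostman_of_lt_dimH h₁ hs0 (hsK.trans_le (min_le_left _ _))
  obtain ⟨μ₂, hμ₂, hK₂, M₂, hM₂, hb₂⟩ :=
    exists_frostman_of_lt_dimH h₂ hs0 (hsK.trans_le (min_le_right _ _))
  refine ⟨s / 4 / 2, M₁ + M₂ * 2 ^ (s / 4 : ℝ) + 1, μ₁.prod μ₂, by positivity, by positivity,
    inferInstance, ?_, fun r hr => ?_⟩
  · rw [compl_prod_eq_union]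
    exact measure_union_null (by simp [hK₁]) (by simp [hK₂])
  · refine (measure_mono fun q hq => hq.2.2.2).trans
      ((prod_triArea_lt_le hM₁ hM₂ hb₁ hb₂ hr).trans (ENNReal.ofReal_le_ofReal ?_))
    exact mul_le_mul_of_nonneg_right (by linarith) (by positivity)
end

section
/- Let U ⊆ ℝ² be a connected open set and P : U → ℝ analytic, with none of ∂ₓP, ∂ᵧP, ∂ₓᵧP vanishing identically on U. Then K_P := ∇P ∧ ∇((∂ₓP · ∂ᵧP)/∂ₓᵧP) vanishes identically on U (wherever defined) if and only if P is an analytic special form. -/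
/-- Partial derivative in the first variable of a function on `ℝ²`. -/
noncomputable def pdx (f : ℝ × ℝ → ℝ) : ℝ × ℝ → ℝ :=
  fun p => deriv (fun t => f (t, p.2)) p.1

/-- Partial derivative in the second variable of a function on `ℝ²`. -/
noncomputable def pdy (f : ℝ × ℝ → ℝ) : ℝ × ℝ → ℝ :=
  fun p => deriv (fun t => f (p.1, t)) p.2

/-- `P` is an *analytic special form* on `U` if, on each connected component of
`U \ ({∂ₓP = 0} ∪ {∂ᵧP = 0})`, there are univariate real analytic functions `h, a, b`
with `P(x,y) = h(a x + b y)`. -/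
def IsAnalyticSpecialForm (U : Set (ℝ × ℝ)) (P : ℝ × ℝ → ℝ) : Prop :=
  ∀ p ∈ {q ∈ U | pdx P q ≠ 0 ∧ pdy P q ≠ 0},
    ∃ h a b : ℝ → ℝ,
      AnalyticOnNhd ℝ a
          (Prod.fst '' connectedComponentIn {q ∈ U | pdx P q ≠ 0 ∧ pdy P q ≠ 0} p) ∧
      AnalyticOnNhd ℝ b
          (Prod.snd '' connectedComponentIn {q ∈ U | pdx P q ≠ 0 ∧ pdy P q ≠ 0} p) ∧
      AnalyticOnNhd ℝ h
          ((fun q : ℝ × ℝ => a q.1 + b q.2) ''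
            connectedComponentIn {q ∈ U | pdx P q ≠ 0 ∧ pdy P q ≠ 0} p) ∧
      ∀ q ∈ connectedComponentIn {q ∈ U | pdx P q ≠ 0 ∧ pdy P q ≠ 0} p,
        P q = h (a q.1 + b q.2)

open Filter Topology Set

/-- If the derivative of `F` is analytic near a point, then so is `F`. -/
theorem AnalyticAt.of_eventually_hasDerivAt {F f : ℝ → ℝ} {x₀ : ℝ} (hf : AnalyticAt ℝ f x₀)
    (hF : ∀ᶠ x in 𝓝 x₀, HasDerivAt F (f x) x) : AnalyticAt ℝ F x₀ := by
  obtain ⟨p, hp⟩ := hf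
  have hsum := hasFPowerSeriesAt_iff'.1 hp
  obtain ⟨r, hr⟩ := hp
  obtain ⟨R, hR0, hRr⟩ := ENNReal.lt_iff_exists_nnreal_btwn.1 hr.r_pos
  have hR0 : (0 : ℝ) < R := by exact_mod_cast hR0
  have hu : Summable fun n => ‖p n‖ * (R : ℝ) ^ n :=
    p.summable_norm_mul_pow (hRr.trans_le hr.r_le)
  set g : ℕ → ℝ → ℝ := fun n z => (z - x₀) ^ (n + 1) * (p.coeff n / (n + 1)) with hg_def
  have hg : ∀ n z, HasDerivAt (g n) ((z - x₀) ^ n * p.coeff n) z := by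
    intro n z
    have h := (((hasDerivAt_id z).sub_const x₀).pow (n + 1)).mul_const (p.coeff n / (n + 1))
    have hn : (n + 1 : ℝ) ≠ 0 := by positivity
    convert! h using 1
    simp only [id, Nat.cast_add, Nat.cast_one, add_tsub_cancel_right]
    field_simp
  have hg' : ∀ n z, z ∈ Metric.ball x₀ R → ‖(z - x₀) ^ n * p.coeff n‖ ≤ ‖p n‖ * (R : ℝ) ^ n := by
    intro n z hz
    rw [norm_mul, norm_pow, mul_comm, p.norm_apply_eq_norm_coef]
    have : ‖z - x₀‖ ≤ R := (mem_ball_iff_norm.1 hz).le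
    gcongr
  have hx₀ : x₀ ∈ Metric.ball x₀ (R : ℝ) := Metric.mem_ball_self hR0
  have hpc : IsPreconnected (Metric.ball x₀ (R : ℝ)) := (convex_ball _ _).isPreconnected
  have hg0 : Summable fun n => g n x₀ := by simp [hg_def]
  have hG : AnalyticAt ℝ (fun z => ∑' n, g n z) x₀ := by
    refine ⟨.ofScalars ℝ (fun n => Nat.casesOn n 0 fun n => p.coeff n / (n + 1)),
      hasFPowerSeriesAt_iff'.2 ?_⟩
    filter_upwards [Metric.ball_mem_nhds x₀ hR0] with z hz
    have h : HasSum (fun n => g n z) (∑' n, g n z) :=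
      (summable_of_summable_hasDerivAt_of_isPreconnected hu Metric.isOpen_ball hpc
        (fun n y _ => hg n y) hg' hx₀ hg0 hz).hasSum
    rw [← hasSum_nat_add_iff' 1]
    simpa [hg_def, FormalMultilinearSeries.coeff_ofScalars] using h
  have hGd : ∀ᶠ z in 𝓝 x₀, HasDerivAt (fun z => ∑' n, g n z) (f z) z := by
    filter_upwards [Metric.ball_mem_nhds x₀ hR0, hsum] with z hz hfz
    rw [← hfz.tsum_eq]
    exact hasDerivAt_tsum_of_isPreconnected hu Metric.isOpen_ball hpc
      (fun n y _ => hg n y) hg' hx₀ hg0 hz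
  obtain ⟨ε, hε, hball⟩ := Metric.eventually_nhds_iff_ball.1 (hF.and hGd)
  obtain ⟨c, hc⟩ := Metric.isOpen_ball.exists_is_const_of_deriv_eq_zero
    (f := fun z => F z - ∑' n, g n z) (convex_ball x₀ ε).isPreconnected
    (fun z hz => ((hball z hz).1.sub (hball z hz).2).differentiableAt.differentiableWithinAt)
    (fun z hz => (((hball z hz).1.sub (hball z hz).2).congr_deriv (sub_self _)).deriv)
  refine (hG.add (analyticAt_const (v := c))).congr ?_
  filter_upwards [Metric.ball_mem_nhds x₀ hε] with z hz
  have := hc z hz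
  simp only [Pi.add_apply]
  linarith

/-- An analytic function on an open interval has an analytic primitive there. -/
theorem AnalyticOnNhd.exists_primitive {f : ℝ → ℝ} {I : Set ℝ} (hI : IsOpen I)
    (hIc : IsPreconnected I) (hf : AnalyticOnNhd ℝ f I) :
    ∃ F : ℝ → ℝ, AnalyticOnNhd ℝ F I ∧ ∀ x ∈ I, HasDerivAt F (f x) x := by
  rcases I.eq_empty_or_nonempty with rfl | ⟨x₀, hx₀⟩
  · exact ⟨0, by simp [AnalyticOnNhd], by simp⟩
  have hd : ∀ x ∈ I, HasDerivAt (fun x => ∫ t in x₀..x, f t) (f x) x := by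
    intro x hx
    refine intervalIntegral.integral_hasDerivAt_right
      ((hf.continuousOn.mono ?_).intervalIntegrable)
      (hf.continuousOn.stronglyMeasurableAtFilter hI x hx) (hf x hx).continuousAt
    exact hIc.ordConnected.uIcc_subset hx₀ hx
  refine ⟨_, fun x hx => (hf x hx).of_eventually_hasDerivAt ?_, hd⟩
  filter_upwards [hI.mem_nhds hx] with y hy using hd y hy

/-- A function which locally factors analytically through an open map to `ℝ` does so globally on a
preconnected open set: germs of analytic functions on `ℝ` have no monodromy. -/
theorem exists_analyticOnNhd_eq_comp {X : Type*} [TopologicalSpace X] {C : Set X}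
    (hC : IsOpen C) (hCc : IsPreconnected C) {σ G : X → ℝ}
    (hσ : ∀ q ∈ C, map σ (𝓝 q) = 𝓝 (σ q))
    (hloc : ∀ q ∈ C, ∃ φ : ℝ → ℝ, AnalyticAt ℝ φ (σ q) ∧ ∀ᶠ z in 𝓝 q, G z = φ (σ z)) :
    ∃ φ : ℝ → ℝ, AnalyticOnNhd ℝ φ (σ '' C) ∧ ∀ q ∈ C, G q = φ (σ q) := by
  have germ : ∀ {q}, q ∈ C → ∀ {φ ψ : ℝ → ℝ}, (∀ᶠ z in 𝓝 q, G z = φ (σ z)) →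
      (∀ᶠ z in 𝓝 q, G z = ψ (σ z)) → φ =ᶠ[𝓝 (σ q)] ψ := by
    intro q hq φ ψ hφ hψ
    rw [← hσ q hq]
    exact eventually_map.2 (by filter_upwards [hφ, hψ] with z h1 h2 using h1.symm.trans h2)
  have cont : ∀ q ∈ C, Tendsto σ (𝓝 q) (𝓝 (σ q)) := fun q hq => (hσ q hq).le
  have fiber : ∀ p ∈ C, ∀ q ∈ C, σ q = σ p → G q = G p := by
    intro p₀ hp₀
    let S : Set X := {q | ∃ (J : Set ℝ) (φ : ℝ → ℝ), IsOpen J ∧ IsPreconnected J ∧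
      AnalyticOnNhd ℝ φ J ∧ σ p₀ ∈ J ∧ σ q ∈ J ∧ (∀ᶠ z in 𝓝 p₀, G z = φ (σ z)) ∧
      ∀ᶠ z in 𝓝 q, G z = φ (σ z)}
    have ball : ∀ q ∈ C, ∃ (N : Set ℝ) (φ : ℝ → ℝ), IsOpen N ∧ IsPreconnected N ∧
        AnalyticOnNhd ℝ φ N ∧ σ q ∈ N ∧ ∀ᶠ z in 𝓝 q, G z = φ (σ z) := by
      intro q hq
      obtain ⟨φ, hφ, h⟩ := hloc q hq
      obtain ⟨ε, hε, hb⟩ := Metric.eventually_nhds_iff_ball.1 hφ.eventually_analyticAt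
      exact ⟨_, φ, Metric.isOpen_ball, (convex_ball _ ε).isPreconnected, hb,
        Metric.mem_ball_self hε, h⟩
    have hp₀S : p₀ ∈ S := by
      obtain ⟨N, φ, hN, hNc, hφ, hm, h⟩ := ball p₀ hp₀
      exact ⟨N, φ, hN, hNc, hφ, hm, hm, h, h⟩
    have hSo : IsOpen (S ∩ C) := by
      refine isOpen_iff_mem_nhds.2 ?_
      rintro q ⟨⟨J, φ, hJ, hJc, hφ, hpJ, hqJ, hp, hq⟩, hqC⟩
      filter_upwards [hC.mem_nhds hqC, cont q hqC (hJ.mem_nhds hqJ),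
        eventually_eventually_nhds.2 hq] with z hzC hzJ hz
      exact ⟨⟨J, φ, hJ, hJc, hφ, hpJ, hzJ, hp, hz⟩, hzC⟩
    have hCS : C ⊆ S ∩ C := by
      refine hCc.subset_of_closure_inter_subset hSo ⟨p₀, hp₀, hp₀S, hp₀⟩ ?_
      rintro q ⟨hqcl, hqC⟩
      obtain ⟨N, ψ, hN, hNc, hψ, hqN, hq⟩ := ball q hqC
      obtain ⟨z, ⟨hzN, hz⟩, ⟨J, φ, hJ, hJc, hφ, hpJ, hzJ, hp, hzφ⟩, hzC⟩ :=
        mem_closure_iff_nhds.1 hqcl _ (inter_mem (cont q hqC (hN.mem_nhds hqN))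
          (eventually_eventually_nhds.2 hq))
      have hJN : EqOn φ ψ (J ∩ N) :=
        (hφ.mono inter_subset_left).eqOn_of_preconnected_of_eventuallyEq
          (hψ.mono inter_subset_right)
          (hJc.ordConnected.inter hNc.ordConnected).isPreconnected ⟨hzJ, hzN⟩ (germ hzC hzφ hz)
      classical
      let χ : ℝ → ℝ := fun s => if s ∈ J then φ s else ψ s
      have hχJ : ∀ s ∈ J, χ s = φ s := fun s hs => if_pos hs
      have hχN : ∀ s ∈ N, χ s = ψ s := by
        intro s hs
        by_cases h : s ∈ J
        · exact (hχJ s h).trans (hJN ⟨h, hs⟩)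
        · exact if_neg h
      refine ⟨⟨J ∪ N, χ, hJ.union hN, hJc.union _ hzJ hzN hNc, ?_, .inl hpJ, .inr hqN, ?_, ?_⟩,
        hqC⟩
      · rintro s (hs | hs)
        · exact (hφ s hs).congr (by filter_upwards [hJ.mem_nhds hs] with t ht using (hχJ t ht).symm)
        · exact (hψ s hs).congr (by filter_upwards [hN.mem_nhds hs] with t ht using (hχN t ht).symm)
      · filter_upwards [hp, cont p₀ hp₀ (hJ.mem_nhds hpJ)] with w hw hwJ
        rw [hw, hχJ _ hwJ]
      · filter_upwards [hq, cont q hqC (hN.mem_nhds hqN)] with w hw hwN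
        rw [hw, hχN _ hwN]
    intro q hq hpq
    obtain ⟨J, φ, -, -, -, -, -, hp, hq⟩ := (hCS hq).1
    rw [hp.self_of_nhds, hq.self_of_nhds, hpq]
  classical
  let φ : ℝ → ℝ := fun s => if h : ∃ q ∈ C, σ q = s then G h.choose else 0
  have hφ : ∀ q ∈ C, G q = φ (σ q) := by
    intro q hq
    have h : ∃ q' ∈ C, σ q' = σ q := ⟨q, hq, rfl⟩
    simp only [φ, dif_pos h]
    exact (fiber _ hq _ h.choose_spec.1 h.choose_spec.2).symm
  refine ⟨φ, ?_, hφ⟩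
  rintro _ ⟨q, hq, rfl⟩
  obtain ⟨ψ, hψ, h⟩ := hloc q hq
  exact hψ.congr (germ hq h (by filter_upwards [hC.mem_nhds hq] with z hz using hφ z hz))

section PartialDerivatives

variable {f g : ℝ × ℝ → ℝ} {p : ℝ × ℝ}

theorem HasFDerivAt.hasDerivAt_slice_fst {f' : ℝ × ℝ →L[ℝ] ℝ} (hf : HasFDerivAt f f' p) :
    HasDerivAt (fun t => f (t, p.2)) (f' (1, 0)) p.1 :=
  HasFDerivAt.comp_hasDerivAt (f := fun t : ℝ => (t, p.2)) p.1 hf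
    ((hasDerivAt_id p.1).prodMk (hasDerivAt_const p.1 p.2))

theorem HasFDerivAt.hasDerivAt_slice_snd {f' : ℝ × ℝ →L[ℝ] ℝ} (hf : HasFDerivAt f f' p) :
    HasDerivAt (fun t => f (p.1, t)) (f' (0, 1)) p.2 :=
  HasFDerivAt.comp_hasDerivAt (f := fun t : ℝ => (p.1, t)) p.2 hf
    ((hasDerivAt_const p.2 p.1).prodMk (hasDerivAt_id p.2))

theorem DifferentiableAt.pdx_eq_fderiv (hf : DifferentiableAt ℝ f p) :
    pdx f p = fderiv ℝ f p (1, 0) :=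
  hf.hasFDerivAt.hasDerivAt_slice_fst.deriv

theorem DifferentiableAt.pdy_eq_fderiv (hf : DifferentiableAt ℝ f p) :
    pdy f p = fderiv ℝ f p (0, 1) :=
  hf.hasFDerivAt.hasDerivAt_slice_snd.deriv

theorem DifferentiableAt.hasDerivAt_pdx (hf : DifferentiableAt ℝ f p) :
    HasDerivAt (fun t => f (t, p.2)) (pdx f p) p.1 :=
  hf.hasFDerivAt.hasDerivAt_slice_fst.differentiableAt.hasDerivAt

theorem DifferentiableAt.hasDerivAt_pdy (hf : DifferentiableAt ℝ f p) :
    HasDerivAt (fun t => f (p.1, t)) (pdy f p) p.2 :=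
  hf.hasFDerivAt.hasDerivAt_slice_snd.differentiableAt.hasDerivAt

theorem DifferentiableAt.fderiv_apply_eq_pd (hf : DifferentiableAt ℝ f p) (u v : ℝ) :
    fderiv ℝ f p (u, v) = u * pdx f p + v * pdy f p := by
  have : ((u, v) : ℝ × ℝ) = u • (1, 0) + v • (0, 1) := by simp
  rw [this, map_add, map_smul, map_smul, hf.pdx_eq_fderiv, hf.pdy_eq_fderiv, smul_eq_mul,
    smul_eq_mul]

theorem Filter.EventuallyEq.pdx_eq (h : f =ᶠ[𝓝 p] g) : pdx f p = pdx g p := by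
  refine EventuallyEq.deriv_eq ?_
  exact (Continuous.tendsto (by fun_prop : Continuous fun t : ℝ => (t, p.2)) p.1).eventually h

theorem Filter.EventuallyEq.pdy_eq (h : f =ᶠ[𝓝 p] g) : pdy f p = pdy g p := by
  refine EventuallyEq.deriv_eq ?_
  exact (Continuous.tendsto (by fun_prop : Continuous fun t : ℝ => (p.1, t)) p.2).eventually h

theorem AnalyticAt.pdx (hf : AnalyticAt ℝ f p) : AnalyticAt ℝ (pdx f) p := by
  refine (((ContinuousLinearMap.apply ℝ ℝ ((1, 0) : ℝ × ℝ)).analyticAt _).comp hf.fderiv).congr ?_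
  filter_upwards [hf.eventually_analyticAt] with q hq using hq.differentiableAt.pdx_eq_fderiv.symm

theorem AnalyticAt.pdy (hf : AnalyticAt ℝ f p) : AnalyticAt ℝ (pdy f) p := by
  refine (((ContinuousLinearMap.apply ℝ ℝ ((0, 1) : ℝ × ℝ)).analyticAt _).comp hf.fderiv).congr ?_
  filter_upwards [hf.eventually_analyticAt] with q hq using hq.differentiableAt.pdy_eq_fderiv.symm

/-- Partial derivatives of an analytic function commute. -/
theorem AnalyticAt.pdx_pdy_comm (hf : AnalyticAt ℝ f p) :
    _root_.pdx (_root_.pdy f) p = _root_.pdy (_root_.pdx f) p := by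
  have hd : DifferentiableAt ℝ (fderiv ℝ f) p := hf.fderiv.differentiableAt
  have hy : _root_.pdy f =ᶠ[𝓝 p] fun q => fderiv ℝ f q (0, 1) := by
    filter_upwards [hf.eventually_analyticAt] with q hq using hq.differentiableAt.pdy_eq_fderiv
  have hx : _root_.pdx f =ᶠ[𝓝 p] fun q => fderiv ℝ f q (1, 0) := by
    filter_upwards [hf.eventually_analyticAt] with q hq using hq.differentiableAt.pdx_eq_fderiv
  rw [hy.pdx_eq, hx.pdy_eq,
    (hd.clm_apply (differentiableAt_const _)).pdx_eq_fderiv,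
    (hd.clm_apply (differentiableAt_const _)).pdy_eq_fderiv,
    fderiv_clm_apply hd (differentiableAt_const _), fderiv_clm_apply hd (differentiableAt_const _)]
  simpa using (hf.contDiffAt (n := ⊤)).isSymmSndFDerivAt_of_omega (1, 0) (0, 1)

theorem eventually_eq_slice_of_hasDerivAt_snd
    (h : ∀ᶠ z in 𝓝 p, HasDerivAt (fun t => f (z.1, t)) 0 z.2) :
    ∀ᶠ z in 𝓝 p, f z = f (z.1, p.2) := by
  obtain ⟨ε, hε, hb⟩ := Metric.eventually_nhds_iff_ball.1 h
  filter_upwards [Metric.ball_mem_nhds p hε] with z hz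
  rw [← ball_prod_same] at hz hb
  exact Metric.isOpen_ball.is_const_of_deriv_eq_zero (f := fun t => f (z.1, t))
    (convex_ball p.2 ε).isPreconnected
    (fun t ht => (hb (z.1, t) ⟨hz.1, ht⟩).differentiableAt.differentiableWithinAt)
    (fun t ht => (hb (z.1, t) ⟨hz.1, ht⟩).deriv) hz.2 (Metric.mem_ball_self hε)

theorem eventually_eq_slice_of_hasDerivAt_fst
    (h : ∀ᶠ z in 𝓝 p, HasDerivAt (fun t => f (t, z.2)) 0 z.1) :
    ∀ᶠ z in 𝓝 p, f z = f (p.1, z.2) := by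
  obtain ⟨ε, hε, hb⟩ := Metric.eventually_nhds_iff_ball.1 h
  filter_upwards [Metric.ball_mem_nhds p hε] with z hz
  rw [← ball_prod_same] at hz hb
  exact Metric.isOpen_ball.is_const_of_deriv_eq_zero (f := fun t => f (t, z.2))
    (convex_ball p.1 ε).isPreconnected
    (fun t ht => (hb (t, z.2) ⟨ht, hz.2⟩).differentiableAt.differentiableWithinAt)
    (fun t ht => (hb (t, z.2) ⟨ht, hz.2⟩).deriv) hz.1 (Metric.mem_ball_self hε)

variable {C : Set (ℝ × ℝ)}

theorem AnalyticOnNhd.exists_eq_comp_fst (hC : IsOpen C) (hCc : IsPreconnected C)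
    (hg : AnalyticOnNhd ℝ g C) (h : ∀ q ∈ C, _root_.pdy g q = 0) :
    ∃ φ : ℝ → ℝ, AnalyticOnNhd ℝ φ (Prod.fst '' C) ∧ ∀ q ∈ C, g q = φ q.1 := by
  refine exists_analyticOnNhd_eq_comp hC hCc (fun q _ => map_fst_nhds q) fun q hq =>
    ⟨fun t => g (t, q.2), ?_, eventually_eq_slice_of_hasDerivAt_snd ?_⟩
  · exact AnalyticAt.fun_comp (f := fun t : ℝ => (t, q.2)) (hg q hq)
      (analyticAt_id.prod analyticAt_const)
  · filter_upwards [hC.mem_nhds hq] with z hz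
    exact h z hz ▸ (hg z hz).differentiableAt.hasDerivAt_pdy

theorem AnalyticOnNhd.exists_eq_comp_snd (hC : IsOpen C) (hCc : IsPreconnected C)
    (hg : AnalyticOnNhd ℝ g C) (h : ∀ q ∈ C, _root_.pdx g q = 0) :
    ∃ φ : ℝ → ℝ, AnalyticOnNhd ℝ φ (Prod.snd '' C) ∧ ∀ q ∈ C, g q = φ q.2 := by
  refine exists_analyticOnNhd_eq_comp hC hCc (fun q _ => map_snd_nhds q) fun q hq =>
    ⟨fun t => g (q.1, t), ?_, eventually_eq_slice_of_hasDerivAt_fst ?_⟩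
  · exact AnalyticAt.fun_comp (f := fun t : ℝ => (q.1, t)) (hg q hq)
      (analyticAt_const.prod analyticAt_id)
  · filter_upwards [hC.mem_nhds hq] with z hz
    exact h z hz ▸ (hg z hz).differentiableAt.hasDerivAt_pdx

/-- A nonvanishing function whose logarithmic derivative separates is, up to a constant, a quotient
of derivatives of univariate functions. -/
theorem AnalyticOnNhd.exists_deriv_mul_deriv (hC : IsOpen C) (hCc : IsConnected C)
    {r g₁ g₂ : ℝ × ℝ → ℝ} (hr : AnalyticOnNhd ℝ r C) (hr0 : ∀ q ∈ C, r q ≠ 0)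
    (hg₁ : AnalyticOnNhd ℝ g₁ C) (hg₂ : AnalyticOnNhd ℝ g₂ C)
    (hx : ∀ q ∈ C, _root_.pdx r q = g₁ q * r q) (hy : ∀ q ∈ C, _root_.pdy r q = g₂ q * r q)
    (h₁ : ∀ q ∈ C, _root_.pdy g₁ q = 0) (h₂ : ∀ q ∈ C, _root_.pdx g₂ q = 0) :
    ∃ a b : ℝ → ℝ, AnalyticOnNhd ℝ a (Prod.fst '' C) ∧ AnalyticOnNhd ℝ b (Prod.snd '' C) ∧
      (∀ q ∈ C, deriv a q.1 ≠ 0) ∧ ∀ q ∈ C, r q * deriv b q.2 = deriv a q.1 := by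
  obtain ⟨φ, hφ, hgφ⟩ := hg₁.exists_eq_comp_fst hC hCc.isPreconnected h₁
  obtain ⟨ψ, hψ, hgψ⟩ := hg₂.exists_eq_comp_snd hC hCc.isPreconnected h₂
  have hI : IsOpen (Prod.fst '' C) := isOpenMap_fst _ hC
  have hJ : IsOpen (Prod.snd '' C) := isOpenMap_snd _ hC
  have hIc := hCc.isPreconnected.image _ continuous_fst.continuousOn
  have hJc := hCc.isPreconnected.image _ continuous_snd.continuousOn
  obtain ⟨A, hA, hA'⟩ := hφ.exists_primitive hI hIc
  obtain ⟨B, hB, hB'⟩ := hψ.exists_primitive hJ hJc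
  let E : ℝ × ℝ → ℝ := fun q => r q * (Real.exp (-A q.1) * Real.exp (-B q.2))
  have hE : ∀ q ∈ C, DifferentiableAt ℝ E q := by
    intro q hq
    have hAq := (hA _ (mem_image_of_mem _ hq)).differentiableAt.comp q differentiableAt_fst
    have hBq := (hB _ (mem_image_of_mem _ hq)).differentiableAt.comp q differentiableAt_snd
    exact (hr q hq).differentiableAt.mul (hAq.neg.exp.mul hBq.neg.exp)
  have hE0 : ∀ q ∈ C, fderiv ℝ E q = 0 := by
    intro q hq
    have hrq := (hr q hq).differentiableAt
    have hAq := hA' _ (mem_image_of_mem _ hq)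
    have hBq := hB' _ (mem_image_of_mem _ hq)
    have ex : _root_.pdx E q = 0 := by
      refine ((hrq.hasDerivAt_pdx.fun_mul
        (hAq.fun_neg.exp.mul_const (Real.exp (-B q.2)))).congr_deriv ?_).deriv
      rw [hx q hq, hgφ q hq]
      ring
    have ey : _root_.pdy E q = 0 := by
      refine ((hrq.hasDerivAt_pdy.fun_mul
        (hBq.fun_neg.exp.const_mul (Real.exp (-A q.1)))).congr_deriv ?_).deriv
      rw [hy q hq, hgψ q hq]
      ring
    ext <;> simp [(hE q hq).fderiv_apply_eq_pd, ex, ey]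
  obtain ⟨c, hc⟩ := hC.exists_is_const_of_fderiv_eq_zero hCc.isPreconnected
    (fun q hq => (hE q hq).differentiableWithinAt) hE0
  have hc0 : c ≠ 0 := by
    obtain ⟨q, hq⟩ := hCc.nonempty
    rw [← hc q hq]
    exact mul_ne_zero (hr0 q hq) (by positivity)
  obtain ⟨a, ha, ha'⟩ := AnalyticOnNhd.exists_primitive (f := fun x => c * Real.exp (A x)) hI hIc
    fun x hx => analyticAt_const.mul (hA x hx).rexp
  obtain ⟨b, hb, hb'⟩ := AnalyticOnNhd.exists_primitive (f := fun y => Real.exp (-B y)) hJ hJc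
    fun y hy => (hB y hy).neg.rexp
  refine ⟨a, b, ha, hb, fun q hq => ?_, fun q hq => ?_⟩
  · rw [(ha' _ (mem_image_of_mem _ hq)).deriv]
    exact mul_ne_zero hc0 (Real.exp_pos _).ne'
  · rw [(ha' _ (mem_image_of_mem _ hq)).deriv, (hb' _ (mem_image_of_mem _ hq)).deriv, ← hc q hq]
    simp only [E]
    rw [mul_assoc, mul_right_comm, ← Real.exp_add, neg_add_cancel, Real.exp_zero, one_mul]

/-- An analytic function whose gradient is parallel to that of `a x + b y` factors through
`a x + b y`. -/
theorem AnalyticOnNhd.exists_eq_comp_add (hC : IsOpen C) (hCc : IsPreconnected C)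
    {P : ℝ × ℝ → ℝ} (hP : AnalyticOnNhd ℝ P C) {a b : ℝ → ℝ}
    (ha : AnalyticOnNhd ℝ a (Prod.fst '' C)) (hb : AnalyticOnNhd ℝ b (Prod.snd '' C))
    (ha0 : ∀ q ∈ C, deriv a q.1 ≠ 0)
    (h : ∀ q ∈ C, _root_.pdx P q * deriv b q.2 = _root_.pdy P q * deriv a q.1) :
    ∃ φ : ℝ → ℝ, AnalyticOnNhd ℝ φ ((fun q : ℝ × ℝ => a q.1 + b q.2) '' C) ∧
      ∀ q ∈ C, P q = φ (a q.1 + b q.2) := by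
  have haq : ∀ q ∈ C, AnalyticAt ℝ a q.1 := fun q hq => ha _ (mem_image_of_mem _ hq)
  have hbq : ∀ q ∈ C, AnalyticAt ℝ b q.2 := fun q hq => hb _ (mem_image_of_mem _ hq)
  refine exists_analyticOnNhd_eq_comp (σ := fun q : ℝ × ℝ => a q.1 + b q.2) hC hCc
    (fun q hq => ?_) fun q hq => ?_
  · have hs : HasStrictFDerivAt (fun q : ℝ × ℝ => a q.1 + b q.2) _ q :=
      ((haq q hq).hasStrictDerivAt.hasStrictFDerivAt.comp q hasStrictFDerivAt_fst).add
        ((hbq q hq).hasStrictDerivAt.hasStrictFDerivAt.comp q hasStrictFDerivAt_snd)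
    refine hs.map_nhds_eq_of_surj (LinearMap.range_eq_top.2 fun t => ⟨(t / deriv a q.1, 0), ?_⟩)
    simp [ha0 q hq]
  · have hs := (haq q hq).hasStrictDerivAt
    have hψ := (haq q hq).analyticAt_localInverse (ha0 q hq)
    have hl := hs.eventually_left_inverse (ha0 q hq)
    have hr := hs.eventually_right_inverse (ha0 q hq)
    set ψ := hs.localInverse _ _ _ (ha0 q hq)
    have hψq : ψ (a q.1) = q.1 := hl.self_of_nhds
    have hb' : AnalyticAt ℝ (fun u => ψ (u - b q.2)) (a q.1 + b q.2) :=
      AnalyticAt.fun_comp (g := ψ) (by simpa using hψ) (analyticAt_id.sub analyticAt_const)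
    have hψd : ∀ᶠ w in 𝓝 (a q.1), HasDerivAt ψ (deriv ψ w) w ∧ a (ψ w) = w := by
      filter_upwards [hψ.eventually_analyticAt, hr] with w hw hrw
      exact ⟨hw.differentiableAt.hasDerivAt, hrw⟩
    have hψd := hψd.and (eventually_eventually_nhds.2 hr)
    let s : ℝ × ℝ := (a q.1 + b q.2, q.2)
    have hcb : ContinuousAt (fun z : ℝ × ℝ => b z.2) s :=
      (hbq q hq).continuousAt.comp (f := Prod.snd) (x := s) continuousAt_snd
    have hv : Tendsto (fun z : ℝ × ℝ => z.1 - b z.2) (𝓝 s) (𝓝 (a q.1)) := by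
      have : ContinuousAt (fun z : ℝ × ℝ => z.1 - b z.2) s := continuousAt_fst.sub hcb
      simpa [ContinuousAt, s] using this
    have hzC : ∀ᶠ z in 𝓝 s, (ψ (z.1 - b z.2), z.2) ∈ C := by
      have h1 : Tendsto (fun z : ℝ × ℝ => ψ (z.1 - b z.2)) (𝓝 s) (𝓝 q.1) := by
        have := hψ.continuousAt.tendsto.comp hv
        rwa [hψq] at this
      have h2 : Tendsto (fun z : ℝ × ℝ => (ψ (z.1 - b z.2), z.2)) (𝓝 s) (𝓝 q) :=
        h1.prodMk_nhds (continuousAt_snd (p := s))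
      exact h2 (hC.mem_nhds hq)
    have hF := eventually_eq_slice_of_hasDerivAt_snd (p := s)
      (f := fun z => P (ψ (z.1 - b z.2), z.2)) (by
        filter_upwards [hzC, hv.eventually hψd] with z hz hw
        obtain ⟨⟨hψz, -⟩, haψ⟩ := hw
        have hbz : HasDerivAt b (deriv b z.2) z.2 := (hbq _ hz).differentiableAt.hasDerivAt
        have haz : HasDerivAt a (deriv a (ψ (z.1 - b z.2))) (ψ (z.1 - b z.2)) :=
          (haq _ hz).differentiableAt.hasDerivAt
        have hinv : deriv a (ψ (z.1 - b z.2)) * deriv ψ (z.1 - b z.2) = 1 :=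
          (haz.comp _ hψz).unique ((hasDerivAt_id _).congr_of_eventuallyEq haψ)
        have hPz := (hP _ hz).differentiableAt
        refine (HasFDerivAt.comp_hasDerivAt (f := fun t => (ψ (z.1 - b t), t)) z.2 hPz.hasFDerivAt
          ((hψz.comp z.2 (hbz.const_sub z.1)).prodMk (hasDerivAt_id z.2))).congr_deriv ?_
        rw [hPz.fderiv_apply_eq_pd]
        linear_combination -deriv ψ (z.1 - b z.2) * h _ hz -
          _root_.pdy P (ψ (z.1 - b z.2), z.2) * hinv)
    refine ⟨fun u => P (ψ (u - b q.2), q.2), ?_, ?_⟩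
    · refine AnalyticAt.fun_comp (f := fun u => (ψ (u - b q.2), q.2)) ?_ (hb'.prod analyticAt_const)
      simpa [hψq] using hP q hq
    · have hc : Tendsto (fun z : ℝ × ℝ => (a z.1 + b z.2, z.2)) (𝓝 q) (𝓝 s) :=
        ((((haq q hq).continuousAt.comp (f := Prod.fst) continuousAt_fst).add
          ((hbq q hq).continuousAt.comp (f := Prod.snd) continuousAt_snd))).prodMk_nhds
            (continuousAt_snd (p := q))
      filter_upwards [hc.eventually hF, continuousAt_fst.eventually hl] with z hz hlz
      simpa [hlz, s] using hz

end PartialDerivatives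

section SpecialForm

variable {U : Set (ℝ × ℝ)} {P : ℝ × ℝ → ℝ} {p : ℝ × ℝ}

/-- Analytic functions on a connected open set have no zero divisors. -/
theorem AnalyticOnNhd.eq_zero_of_mul_eq_zero {f g : ℝ × ℝ → ℝ} (hUo : IsOpen U)
    (hU : IsPreconnected U) (hf : AnalyticOnNhd ℝ f U) (hg : AnalyticOnNhd ℝ g U)
    (h : ∀ q ∈ U, f q * g q = 0) (hf0 : ¬ ∀ q ∈ U, f q = 0) : ∀ q ∈ U, g q = 0 := by
  push Not at hf0
  obtain ⟨q, hq, hfq⟩ := hf0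
  refine hg.eqOn_zero_of_preconnected_of_eventuallyEq_zero hU hq ?_
  filter_upwards [(hf q hq).continuousAt.eventually_ne hfq, hUo.mem_nhds hq] with z hz hzU
  exact (mul_eq_zero.1 (h z hzU)).resolve_left hz

/-- The numerator of `∇P ∧ ∇(∂ₓP ∂ᵧP / ∂ₓᵧP)`. -/
noncomputable def wedgeNumerator (P : ℝ × ℝ → ℝ) (q : ℝ × ℝ) : ℝ :=
  pdy P q ^ 2 * (pdx P q * pdx (pdx (pdy P)) q - pdx (pdx P) q * pdx (pdy P) q) -
    pdx P q ^ 2 * (pdy P q * pdy (pdx (pdy P)) q - pdx (pdy P) q * pdy (pdy P) q)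

theorem AnalyticAt.wedgeNumerator (hP : AnalyticAt ℝ P p) :
    AnalyticAt ℝ (wedgeNumerator P) p := by
  have hx := hP.pdx
  have hy := hP.pdy
  exact ((hy.pow 2).mul ((hx.mul hy.pdx.pdx).sub (hx.pdx.mul hy.pdx))).sub
    ((hx.pow 2).mul ((hy.mul hy.pdx.pdy).sub (hy.pdx.mul hy.pdy)))

theorem AnalyticAt.wedge_eq_wedgeNumerator_div (hP : AnalyticAt ℝ P p)
    (h : _root_.pdx (_root_.pdy P) p ≠ 0) :
    _root_.pdx P p * _root_.pdy (fun q => _root_.pdx P q * _root_.pdy P q /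
        _root_.pdx (_root_.pdy P) q) p -
      _root_.pdy P p * _root_.pdx (fun q => _root_.pdx P q * _root_.pdy P q /
        _root_.pdx (_root_.pdy P) q) p =
      _root_.wedgeNumerator P p / _root_.pdx (_root_.pdy P) p ^ 2 := by
  have hx := hP.pdx.differentiableAt
  have hy := hP.pdy.differentiableAt
  have hxy := hP.pdy.pdx.differentiableAt
  have e₁ := ((hx.hasDerivAt_pdx.fun_mul hy.hasDerivAt_pdx).fun_div hxy.hasDerivAt_pdx h).deriv
  have e₂ := ((hx.hasDerivAt_pdy.fun_mul hy.hasDerivAt_pdy).fun_div hxy.hasDerivAt_pdy h).deriv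
  rw [_root_.pdx.eq_def (fun q => _ / _), _root_.pdy.eq_def (fun q => _ / _), e₁, e₂,
    ← hP.pdx_pdy_comm, _root_.wedgeNumerator]
  field_simp
  ring

theorem Filter.EventuallyEq.pdx {f g : ℝ × ℝ → ℝ} (h : f =ᶠ[𝓝 p] g) : pdx f =ᶠ[𝓝 p] pdx g :=
  (eventually_eventually_nhds.2 h).mono fun _ hq => EventuallyEq.pdx_eq hq

theorem Filter.EventuallyEq.pdy {f g : ℝ × ℝ → ℝ} (h : f =ᶠ[𝓝 p] g) : pdy f =ᶠ[𝓝 p] pdy g :=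
  (eventually_eventually_nhds.2 h).mono fun _ hq => EventuallyEq.pdy_eq hq

theorem pdx_comp_add {F a b : ℝ → ℝ} (hF : DifferentiableAt ℝ F (a p.1 + b p.2))
    (ha : DifferentiableAt ℝ a p.1) :
    pdx (fun q => F (a q.1 + b q.2)) p = deriv F (a p.1 + b p.2) * deriv a p.1 :=
  (hF.hasDerivAt.comp p.1 (ha.hasDerivAt.add_const (b p.2))).deriv

theorem pdy_comp_add {F a b : ℝ → ℝ} (hF : DifferentiableAt ℝ F (a p.1 + b p.2))
    (hb : DifferentiableAt ℝ b p.2) :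
    pdy (fun q => F (a q.1 + b q.2)) p = deriv F (a p.1 + b p.2) * deriv b p.2 :=
  (hF.hasDerivAt.comp p.2 (hb.hasDerivAt.const_add (a p.1))).deriv

/-- The wedge `∇P ∧ ∇(∂ₓP ∂ᵧP / ∂ₓᵧP)` of a function of the form `h (a x + b y)` vanishes. -/
theorem wedge_eq_zero_of_eventuallyEq_comp_add {h a b : ℝ → ℝ} (ha : AnalyticAt ℝ a p.1)
    (hb : AnalyticAt ℝ b p.2) (hh : AnalyticAt ℝ h (a p.1 + b p.2))
    (hP : P =ᶠ[𝓝 p] fun q => h (a q.1 + b q.2)) (hxy : pdx (pdy P) p ≠ 0) :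
    pdx P p * pdy (fun q => pdx P q * pdy P q / pdx (pdy P) q) p -
      pdy P p * pdx (fun q => pdx P q * pdy P q / pdx (pdy P) q) p = 0 := by
  have ha1 : ∀ᶠ q : ℝ × ℝ in 𝓝 p, AnalyticAt ℝ a q.1 :=
    continuousAt_fst.eventually ha.eventually_analyticAt
  have hb1 : ∀ᶠ q : ℝ × ℝ in 𝓝 p, AnalyticAt ℝ b q.2 :=
    continuousAt_snd.eventually hb.eventually_analyticAt
  have hs : ContinuousAt (fun q : ℝ × ℝ => a q.1 + b q.2) p :=
    (ha.continuousAt.comp (f := Prod.fst) continuousAt_fst).add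
      (hb.continuousAt.comp (f := Prod.snd) continuousAt_snd)
  have hh1 : ∀ᶠ q : ℝ × ℝ in 𝓝 p, AnalyticAt ℝ h (a q.1 + b q.2) :=
    hs.eventually hh.eventually_analyticAt
  have ex : pdx P =ᶠ[𝓝 p] fun q => deriv h (a q.1 + b q.2) * deriv a q.1 := by
    filter_upwards [hP.pdx, ha1, hh1] with q hq haq hhq
    rw [hq, pdx_comp_add hhq.differentiableAt haq.differentiableAt]
  have ey : pdy P =ᶠ[𝓝 p] fun q => deriv h (a q.1 + b q.2) * deriv b q.2 := by
    filter_upwards [hP.pdy, hb1, hh1] with q hq hbq hhq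
    rw [hq, pdy_comp_add hhq.differentiableAt hbq.differentiableAt]
  have exy : pdx (pdy P) =ᶠ[𝓝 p]
      fun q => deriv (deriv h) (a q.1 + b q.2) * deriv a q.1 * deriv b q.2 := by
    filter_upwards [ey.pdx, ha1, hh1] with q hq haq hhq
    rw [hq]
    exact ((hhq.deriv.differentiableAt.hasDerivAt.comp q.1
      (haq.differentiableAt.hasDerivAt.add_const (b q.2))).mul_const (deriv b q.2)).deriv
  have hne : deriv (deriv h) (a p.1 + b p.2) * deriv a p.1 * deriv b p.2 ≠ 0 :=
    ne_of_eq_of_ne exy.self_of_nhds.symm hxy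
  have hF : AnalyticAt ℝ (fun s => deriv h s ^ 2 / deriv (deriv h) s) (a p.1 + b p.2) :=
    (hh.deriv.pow 2).div hh.deriv.deriv (left_ne_zero_of_mul (left_ne_zero_of_mul hne))
  have eQ : (fun q => pdx P q * pdy P q / pdx (pdy P) q) =ᶠ[𝓝 p]
      fun q => (fun s => deriv h s ^ 2 / deriv (deriv h) s) (a q.1 + b q.2) := by
    have ha0 := ha.deriv.continuousAt.comp (f := Prod.fst) (x := p) continuousAt_fst
    have hb0 := hb.deriv.continuousAt.comp (f := Prod.snd) (x := p) continuousAt_snd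
    filter_upwards [ex, ey, exy,
      ha0.eventually_ne (right_ne_zero_of_mul (left_ne_zero_of_mul hne)),
      hb0.eventually_ne (right_ne_zero_of_mul hne)] with q h₁ h₂ h₃ ha0 hb0
    simp only [Function.comp_apply] at ha0 hb0
    rw [h₁, h₂, h₃]
    field_simp
  rw [eQ.pdx_eq, eQ.pdy_eq, ex.self_of_nhds, ey.self_of_nhds,
    pdx_comp_add hF.differentiableAt ha.differentiableAt,
    pdy_comp_add hF.differentiableAt hb.differentiableAt]
  ring

/-- If the numerator of the wedge vanishes, then `P` has special form on connected open sets where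
`∂ₓP` and `∂ᵧP` do not vanish. -/
theorem exists_eq_comp_add_of_wedgeNumerator_eq_zero {C : Set (ℝ × ℝ)} (hC : IsOpen C)
    (hCc : IsConnected C) (hP : AnalyticOnNhd ℝ P C) (hx : ∀ q ∈ C, pdx P q ≠ 0)
    (hy : ∀ q ∈ C, pdy P q ≠ 0) (hN : ∀ q ∈ C, wedgeNumerator P q = 0) :
    ∃ h a b : ℝ → ℝ, AnalyticOnNhd ℝ a (Prod.fst '' C) ∧ AnalyticOnNhd ℝ b (Prod.snd '' C) ∧
      AnalyticOnNhd ℝ h ((fun q : ℝ × ℝ => a q.1 + b q.2) '' C) ∧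
      ∀ q ∈ C, P q = h (a q.1 + b q.2) := by
  have hPx : AnalyticOnNhd ℝ (pdx P) C := fun q hq => (hP q hq).pdx
  have hPy : AnalyticOnNhd ℝ (pdy P) C := fun q hq => (hP q hq).pdy
  have hPxy : AnalyticOnNhd ℝ (pdx (pdy P)) C := fun q hq => (hPy q hq).pdx
  have hPxx : AnalyticOnNhd ℝ (pdx (pdx P)) C := fun q hq => (hPx q hq).pdx
  have hPyy : AnalyticOnNhd ℝ (pdy (pdy P)) C := fun q hq => (hPy q hq).pdy
  have comm : ∀ q ∈ C, pdy (pdx P) =ᶠ[𝓝 q] pdx (pdy P) := fun q hq =>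
    (hC.mem_nhds hq |> Filter.mem_of_superset <| fun z hz => ((hP z hz).pdx_pdy_comm).symm)
  obtain ⟨a, b, ha, hb, ha0, hab⟩ := AnalyticOnNhd.exists_deriv_mul_deriv hC hCc
    (r := fun q => pdx P q / pdy P q)
    (g₁ := fun q => pdx (pdx P) q / pdx P q - pdx (pdy P) q / pdy P q)
    (g₂ := fun q => pdx (pdy P) q / pdx P q - pdy (pdy P) q / pdy P q)
    (hPx.div hPy hy) (fun q hq => div_ne_zero (hx q hq) (hy q hq))
    ((hPxx.div hPx hx).sub (hPxy.div hPy hy)) ((hPxy.div hPx hx).sub (hPyy.div hPy hy))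
    (fun q hq => by
      have hx0 := hx q hq
      have hy0 := hy q hq
      refine (((hPx q hq).differentiableAt.hasDerivAt_pdx.fun_div
        (hPy q hq).differentiableAt.hasDerivAt_pdx hy0).congr_deriv ?_).deriv
      field_simp)
    (fun q hq => by
      have hx0 := hx q hq
      have hy0 := hy q hq
      refine (((hPx q hq).differentiableAt.hasDerivAt_pdy.fun_div
        (hPy q hq).differentiableAt.hasDerivAt_pdy hy0).congr_deriv ?_).deriv
      rw [(comm q hq).self_of_nhds]
      field_simp)
    (fun q hq => by
      have hx0 := hx q hq
      have hy0 := hy q hq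
      have hNq := hN q hq
      refine ((((hPxx q hq).differentiableAt.hasDerivAt_pdy.fun_div
        (hPx q hq).differentiableAt.hasDerivAt_pdy hx0).fun_sub
        ((hPxy q hq).differentiableAt.hasDerivAt_pdy.fun_div
        (hPy q hq).differentiableAt.hasDerivAt_pdy hy0)).congr_deriv ?_).deriv
      rw [← (hPx q hq).pdx_pdy_comm, (comm q hq).pdx_eq, (comm q hq).self_of_nhds]
      rw [wedgeNumerator] at hNq
      field_simp
      linear_combination hNq)
    (fun q hq => by
      have hx0 := hx q hq
      have hy0 := hy q hq
      have hNq := hN q hq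
      refine ((((hPxy q hq).differentiableAt.hasDerivAt_pdx.fun_div
        (hPx q hq).differentiableAt.hasDerivAt_pdx hx0).fun_sub
        ((hPyy q hq).differentiableAt.hasDerivAt_pdx.fun_div
        (hPy q hq).differentiableAt.hasDerivAt_pdx hy0)).congr_deriv ?_).deriv
      rw [(hPy q hq).pdx_pdy_comm]
      rw [wedgeNumerator] at hNq
      field_simp
      linear_combination hNq)
  obtain ⟨h, hh, hPh⟩ := hP.exists_eq_comp_add hC hCc.isPreconnected ha hb ha0 fun q hq => by
    have hy0 := hy q hq
    have := hab q hq
    field_simp at this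
    linear_combination this
  exact ⟨h, a, b, ha, hb, hh, hPh⟩

end SpecialForm

/-- For `P` analytic on a connected open `U ⊆ ℝ²` with none of
`∂ₓP`, `∂ᵧP`, `∂ₓᵧP` identically zero on `U`, the quantity
`K_P = ∇P ∧ ∇(∂ₓP ∂ᵧP / ∂ₓᵧP)` vanishes identically on `U` (wherever it is defined)
if and only if `P` is an analytic special form. -/
theorem KP_vanishes_iff_specialForm (U : Set (ℝ × ℝ)) (hUo : IsOpen U) (hUc : IsConnected U)
    (P : ℝ × ℝ → ℝ) (hP : AnalyticOnNhd ℝ P U)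
    (hx : ¬ ∀ p ∈ U, pdx P p = 0) (hy : ¬ ∀ p ∈ U, pdy P p = 0)
    (hxy : ¬ ∀ p ∈ U, pdx (pdy P) p = 0) :
    (∀ p ∈ U, pdx (pdy P) p ≠ 0 →
        pdx P p * pdy (fun q => pdx P q * pdy P q / pdx (pdy P) q) p
          - pdy P p * pdx (fun q => pdx P q * pdy P q / pdx (pdy P) q) p = 0)
      ↔ IsAnalyticSpecialForm U P := by
  have hPx : AnalyticOnNhd ℝ (pdx P) U := fun q hq => (hP q hq).pdx
  have hPy : AnalyticOnNhd ℝ (pdy P) U := fun q hq => (hP q hq).pdy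
  have hPxy : AnalyticOnNhd ℝ (pdx (pdy P)) U := fun q hq => (hPy q hq).pdx
  have hNa : AnalyticOnNhd ℝ (wedgeNumerator P) U := fun q hq => (hP q hq).wedgeNumerator
  have hVo : IsOpen {q ∈ U | pdx P q ≠ 0 ∧ pdy P q ≠ 0} := by
    refine isOpen_iff_mem_nhds.2 fun q ⟨hq, hqx, hqy⟩ => ?_
    filter_upwards [hUo.mem_nhds hq, (hPx q hq).continuousAt.eventually_ne hqx,
      (hPy q hq).continuousAt.eventually_ne hqy] with z h₁ h₂ h₃ using ⟨h₁, h₂, h₃⟩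
  constructor
  · intro hK p hp
    have hN : ∀ q ∈ U, wedgeNumerator P q = 0 := by
      refine hPxy.eq_zero_of_mul_eq_zero hUo hUc.isPreconnected hNa (fun q hq => ?_) hxy
      by_cases h : pdx (pdy P) q = 0
      · rw [h, zero_mul]
      · have := hK q hq h
        rw [(hP q hq).wedge_eq_wedgeNumerator_div h, div_eq_zero_iff] at this
        rw [this.resolve_right (pow_ne_zero 2 h), mul_zero]
    have hsub := connectedComponentIn_subset {q ∈ U | pdx P q ≠ 0 ∧ pdy P q ≠ 0} p
    exact exists_eq_comp_add_of_wedgeNumerator_eq_zero hVo.connectedComponentIn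
      (isConnected_connectedComponentIn_iff.2 hp) (hP.mono (hsub.trans (sep_subset _ _)))
      (fun q hq => (hsub hq).2.1) (fun q hq => (hsub hq).2.2) fun q hq => hN q (hsub hq).1
  · intro hS
    have hV : ∀ p ∈ U, pdx P p ≠ 0 → pdy P p ≠ 0 → pdx (pdy P) p ≠ 0 →
        wedgeNumerator P p = 0 := by
      intro p hp hpx hpy hpxy
      obtain ⟨h, a, b, ha, hb, hh, hPh⟩ := hS p ⟨hp, hpx, hpy⟩
      have hpC := mem_connectedComponentIn (F := {q ∈ U | pdx P q ≠ 0 ∧ pdy P q ≠ 0})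
        ⟨hp, hpx, hpy⟩
      have hK := wedge_eq_zero_of_eventuallyEq_comp_add (ha _ (mem_image_of_mem _ hpC))
        (hb _ (mem_image_of_mem _ hpC)) (hh _ (mem_image_of_mem _ hpC))
        (Filter.mem_of_superset (hVo.connectedComponentIn.mem_nhds hpC) hPh) hpxy
      rw [(hP p hp).wedge_eq_wedgeNumerator_div hpxy, div_eq_zero_iff] at hK
      exact hK.resolve_right (pow_ne_zero 2 hpxy)
    have hN : ∀ q ∈ U, wedgeNumerator P q = 0 := by
      have hprod : ∀ q ∈ U, pdx P q * (pdy P q * (pdx (pdy P) q * wedgeNumerator P q)) = 0 := by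
        intro q hq
        by_contra hne
        simp only [mul_eq_zero, not_or] at hne
        exact hne.2.2.2 (hV q hq hne.1 hne.2.1 hne.2.2.1)
      exact hPxy.eq_zero_of_mul_eq_zero hUo hUc.isPreconnected hNa
        (hPy.eq_zero_of_mul_eq_zero hUo hUc.isPreconnected (hPxy.mul hNa)
          (hPx.eq_zero_of_mul_eq_zero hUo hUc.isPreconnected (hPy.mul (hPxy.mul hNa)) hprod hx)
          hy) hxy
    intro p hp hpxy
    rw [(hP p hp).wedge_eq_wedgeNumerator_div hpxy, hN p hp, zero_div]
end
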